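/- arXiv:1309.0681 — 3 statements merged into one kernel-verified Lean document; each statement's English description precedes it below -/
import Mathlib

section
/- The class QRA of quasi-projective relation algebras has the superamalgamation property: for all A_0, A_1, A_2 ∈ QRA and injective homomorphisms i_1 : A_0 → A_1, i_2 : A_0 → A_2, there exist D ∈ QRA and injective homomorphisms m_1 : A_1 → D, m_2 : A_2 → D with m_1 ∘ i_1 = m_2 ∘ i_2, such that for all x ∈ A_1 and y ∈ A_2: if m_1(x) ≤ m_2(y) then there is z ∈ A_0 with x ≤ i_1(z) and i_2(z) ≤ y, and if m_2(y) ≤ m_1(x) then there is z ∈ A_0 with y ≤ i_2(z) and i_1(z) ≤ x. -/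
/-- A relation algebra structure on the Boolean algebra `A`. -/
structure RelAlgebra (A : Type u) [BooleanAlgebra A] where
  comp : A → A → A
  conv : A → A
  one' : A
  comp_assoc : ∀ x y z : A, comp x (comp y z) = comp (comp x y) z
  comp_sup : ∀ x y z : A, comp (x ⊔ y) z = comp x z ⊔ comp y z
  comp_one' : ∀ x : A, comp x one' = x
  conv_conv : ∀ x : A, conv (conv x) = x
  conv_sup : ∀ x y : A, conv (x ⊔ y) = conv x ⊔ conv y
  conv_comp : ∀ x y : A, conv (comp x y) = comp (conv y) (conv x)
  peirce : ∀ x y : A, comp (conv x) (comp x y)ᶜ ≤ yᶜ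

/-- A relation algebra is quasi-projective (`∈ QRA`) if it contains a pair of
quasi-projections. -/
def RelAlgebra.IsQRA {A : Type u} [BooleanAlgebra A] (R : RelAlgebra A) : Prop :=
  ∃ p q : A, R.comp (R.conv p) p ≤ R.one' ∧ R.comp (R.conv q) q ≤ R.one' ∧
    R.comp (R.conv p) q = ⊤

/-- A homomorphism of relation algebras. -/
structure RAHom {A : Type u} {B : Type v} [BooleanAlgebra A] [BooleanAlgebra B]
    (R : RelAlgebra A) (S : RelAlgebra B) where
  toFun : A → B
  map_sup : ∀ x y, toFun (x ⊔ y) = toFun x ⊔ toFun y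
  map_inf : ∀ x y, toFun (x ⊓ y) = toFun x ⊓ toFun y
  map_compl : ∀ x, toFun xᶜ = (toFun x)ᶜ
  map_bot : toFun ⊥ = ⊥
  map_top : toFun ⊤ = ⊤
  map_comp : ∀ x y, toFun (R.comp x y) = S.comp (toFun x) (toFun y)
  map_conv : ∀ x, toFun (R.conv x) = S.conv (toFun x)
  map_one' : toFun R.one' = S.one'

namespace RelAlgebra

variable {A : Type*} [BooleanAlgebra A] (R : RelAlgebra A)

theorem conv_mono {x y : A} (h : x ≤ y) : R.conv x ≤ R.conv y := by
  rw [← sup_eq_right, ← R.conv_sup, sup_eq_right.2 h]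

theorem conv_le_iff {x y : A} : R.conv x ≤ y ↔ x ≤ R.conv y :=
  ⟨fun h => by simpa only [R.conv_conv] using R.conv_mono h,
    fun h => by simpa only [R.conv_conv] using R.conv_mono h⟩

theorem conv_top : R.conv ⊤ = ⊤ :=
  top_le_iff.1 (R.conv_le_iff.1 le_top)

theorem conv_inf (x y : A) : R.conv (x ⊓ y) = R.conv x ⊓ R.conv y :=
  le_antisymm (le_inf (R.conv_mono inf_le_left) (R.conv_mono inf_le_right))
    (R.conv_le_iff.1 (le_inf (R.conv_le_iff.2 inf_le_left) (R.conv_le_iff.2 inf_le_right)))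

theorem comp_sup_right (x y z : A) : R.comp x (y ⊔ z) = R.comp x y ⊔ R.comp x z := by
  rw [← R.conv_conv (R.comp x (y ⊔ z)), R.conv_comp, R.conv_sup, R.comp_sup, R.conv_sup,
    R.conv_comp, R.conv_comp]
  simp only [R.conv_conv]

theorem comp_mono {x x' y y' : A} (hx : x ≤ x') (hy : y ≤ y') : R.comp x y ≤ R.comp x' y' := by
  calc R.comp x y ≤ R.comp x' y := by rw [← sup_eq_right, ← R.comp_sup, sup_eq_right.2 hx]
    _ ≤ R.comp x' y' := by rw [← sup_eq_right, ← R.comp_sup_right, sup_eq_right.2 hy]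

theorem conv_one' : R.conv R.one' = R.one' := by
  have h := R.conv_comp (R.conv R.one') R.one'
  rw [R.comp_one', R.conv_conv, R.comp_one'] at h
  exact h.symm

theorem one'_comp (x : A) : R.comp R.one' x = x := by
  have h := R.conv_comp (R.conv x) R.one'
  rw [R.comp_one', R.conv_conv, R.conv_one'] at h
  exact h.symm

theorem le_comp_top (x : A) : x ≤ R.comp x ⊤ := by
  simpa only [R.comp_one'] using R.comp_mono le_rfl (le_top : R.one' ≤ ⊤) (x := x)

theorem top_comp_top : R.comp ⊤ ⊤ = ⊤ :=
  top_le_iff.1 (R.le_comp_top ⊤)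

theorem comp_top_comp_top (x : A) : R.comp (R.comp x ⊤) ⊤ = R.comp x ⊤ := by
  rw [← R.comp_assoc, R.top_comp_top]

theorem comp_inf_eq_bot {x y z : A} (h : R.comp x y ⊓ z = ⊥) : R.comp (R.conv x) z ⊓ y = ⊥ := by
  rw [← disjoint_iff, ← le_compl_iff_disjoint_right]
  refine (R.comp_mono le_rfl ?_).trans (R.peirce x y)
  rwa [le_compl_iff_disjoint_left, disjoint_iff]

theorem comp_inf_eq_bot' {x y z : A} (h : R.comp (R.conv x) z ⊓ y = ⊥) :
    R.comp x y ⊓ z = ⊥ := by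
  simpa only [R.conv_conv] using R.comp_inf_eq_bot h

theorem comp_bot (x : A) : R.comp x ⊥ = ⊥ := by
  simpa only [inf_top_eq] using R.comp_inf_eq_bot' (x := x) (y := ⊥) (z := ⊤) (inf_bot_eq _)

theorem bot_comp (x : A) : R.comp ⊥ x = ⊥ := by
  have h : R.conv ⊥ = ⊥ := le_bot_iff.1 (R.conv_le_iff.2 bot_le)
  have := congrArg R.conv (R.comp_bot (R.conv x))
  rwa [R.conv_comp, R.conv_conv, h] at this

/-- Dedekind's modular law. -/
theorem comp_inf_le_left (x y z : A) :
    R.comp x y ⊓ z ≤ R.comp x (y ⊓ R.comp (R.conv x) z) := by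
  have h : R.comp x (y ⊓ (R.comp (R.conv x) z)ᶜ) ⊓ z = ⊥ := by
    apply R.comp_inf_eq_bot'
    rw [inf_left_comm, inf_compl_self, inf_bot_eq]
  conv_lhs => rw [← sup_inf_inf_compl (x := y) (y := R.comp (R.conv x) z), R.comp_sup_right,
    inf_sup_right, h, sup_bot_eq]
  exact inf_le_left

theorem comp_inf_le_right (x y z : A) :
    R.comp x y ⊓ z ≤ R.comp (x ⊓ R.comp z (R.conv y)) y := by
  have h := R.conv_mono (R.comp_inf_le_left (R.conv y) (R.conv x) (R.conv z))
  simpa only [R.conv_inf, R.conv_comp, R.conv_conv] using h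

/-- An element is functional if it behaves like a partial function. -/
def Functional (f : A) : Prop := R.comp (R.conv f) f ≤ R.one'

variable {R}

theorem Functional.comp {f g : A} (hf : R.Functional f) (hg : R.Functional g) :
    R.Functional (R.comp f g) := by
  unfold Functional at *
  rw [R.conv_comp, R.comp_assoc, ← R.comp_assoc (R.conv g)]
  refine (R.comp_mono (R.comp_mono le_rfl hf) le_rfl).trans ?_
  rwa [R.comp_one']

theorem Functional.comp_inf_comp_top_le {g x : A} (hg : R.Functional g) (hx : x ≤ g) (s : A) :
    R.comp g s ⊓ R.comp x ⊤ ≤ R.comp x s := by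
  rw [inf_comm]
  refine (R.comp_inf_le_left x ⊤ _).trans (R.comp_mono le_rfl ?_)
  rw [top_inf_eq, R.comp_assoc]
  refine (R.comp_mono ((R.comp_mono (R.conv_mono hx) le_rfl).trans hg) le_rfl).trans ?_
  rw [R.one'_comp]

theorem Functional.inf_comp_top_le {g x : A} (hg : R.Functional g) (hx : x ≤ g) :
    g ⊓ R.comp x ⊤ ≤ x := by
  simpa only [R.comp_one'] using hg.comp_inf_comp_top_le hx R.one'

theorem Functional.comp_inf {f : A} (hf : R.Functional f) (a b : A) :
    R.comp f (a ⊓ b) = R.comp f a ⊓ R.comp f b := by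
  refine le_antisymm (le_inf (R.comp_mono le_rfl inf_le_left) (R.comp_mono le_rfl inf_le_right))
    ((R.comp_inf_le_left f a _).trans (R.comp_mono le_rfl (inf_le_inf_left _ ?_)))
  rw [R.comp_assoc]
  exact (R.comp_mono hf le_rfl).trans (R.one'_comp b).le

theorem Functional.conv_comp_comp_le {f : A} (hf : R.Functional f) (a : A) :
    R.comp (R.conv f) (R.comp f a) ≤ a := by
  rw [R.comp_assoc]
  exact (R.comp_mono hf le_rfl).trans (R.one'_comp a).le

variable (R)

theorem comp_top_inf_comp_top_le (x y : A) :
    R.comp x ⊤ ⊓ R.comp y ⊤ ≤ R.comp (y ⊓ R.comp x ⊤) ⊤ := by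
  rw [inf_comm]
  refine (R.comp_inf_le_right y ⊤ _).trans ?_
  rw [R.conv_top, R.comp_top_comp_top]

/-- The domain of the part of `f ; r` that agrees with `g`: for functional `f` and `g`, the points
`u` at which `f u` is `r`-related to `g u`. -/
def rel (f g r : A) : A := R.comp (R.comp f r ⊓ g) ⊤

theorem rel_sup (f g r s : A) : R.rel f g (r ⊔ s) = R.rel f g r ⊔ R.rel f g s := by
  rw [rel, R.comp_sup_right, inf_sup_right, R.comp_sup, rel, rel]

theorem le_rel_top (f g : A) : R.comp f ⊤ ⊓ R.comp g ⊤ ≤ R.rel f g ⊤ := by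
  rw [rel, inf_comm (R.comp f ⊤) g]
  exact R.comp_top_inf_comp_top_le f g

theorem rel_inf_rel_compl {f g : A} (hf : R.Functional f) (hg : R.Functional g) (r : A) :
    R.rel f g r ⊓ R.rel f g rᶜ = ⊥ := by
  refine le_bot_iff.1 ((R.comp_top_inf_comp_top_le _ _).trans ?_)
  have h : R.comp f rᶜ ⊓ g ⊓ R.comp (R.comp f r ⊓ g) ⊤ ≤ R.comp f (r ⊓ rᶜ) := by
    rw [hf.comp_inf]
    exact le_inf ((inf_le_inf_right _ inf_le_right).trans
      ((hg.inf_comp_top_le inf_le_right).trans inf_le_left)) (inf_le_left.trans inf_le_left)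
  rw [inf_compl_self, R.comp_bot] at h
  rw [le_bot_iff.1 h, R.bot_comp]

theorem rel_conv_le (f g r : A) : R.rel f g r ≤ R.rel g f (R.conv r) := by
  refine (R.comp_mono ((R.comp_inf_le_right f r g).trans (R.comp_mono le_rfl le_top)) le_rfl).trans
    ?_
  rw [R.comp_top_comp_top, inf_comm, rel]

theorem rel_inf_rel_le (f : A) {g : A} (hg : R.Functional g) (h r s : A) :
    R.rel f g r ⊓ R.rel g h s ≤ R.rel f h (R.comp r s) := by
  refine (R.comp_top_inf_comp_top_le _ _).trans (R.comp_mono (le_inf ?_ ?_) le_rfl)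
  · refine (inf_le_inf_right _ inf_le_left).trans ((hg.comp_inf_comp_top_le inf_le_right s).trans ?_)
    rw [R.comp_assoc]
    exact R.comp_mono inf_le_left le_rfl
  · exact inf_le_left.trans inf_le_right

theorem rel_one' (f : A) : R.rel f f R.one' = R.comp f ⊤ := by
  rw [rel, R.comp_one', inf_idem]

theorem rel_comp_le (f g r s : A) :
    R.rel f g (R.comp r s) ≤ R.comp (R.comp f r ⊓ R.comp g (R.conv s)) ⊤ := by
  refine (R.comp_mono ?_ le_rfl).trans (R.comp_top_comp_top _).le
  rw [R.comp_assoc]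
  exact (R.comp_inf_le_right _ s g).trans (R.comp_mono le_rfl le_top)

theorem rel_comp_comp {p : A} (hp : R.Functional p) (f g r : A) :
    R.rel (R.comp p f) (R.comp p g) r = R.comp p (R.rel f g r) := by
  rw [rel, ← R.comp_assoc, ← hp.comp_inf, rel, R.comp_assoc]

theorem conv_comp_rel_le (p q t : A) (hpq : R.comp (R.conv p) q = ⊤) :
    t ≤ R.comp (R.conv p) (R.comp p t ⊓ q) := by
  have := R.comp_inf_le_left (R.conv p) q t
  rwa [hpq, top_inf_eq, R.conv_conv, inf_comm] at this

end RelAlgebra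

/-- The structure on `U → U → Prop` given by the full algebra of binary relations on `U`. -/
def RelAlgebra.full (U : Type*) : RelAlgebra (U → U → Prop) where
  comp r s a b := ∃ c, r a c ∧ s c b
  conv r a b := r b a
  one' a b := a = b
  comp_assoc _ _ _ := by
    ext a b
    exact ⟨fun ⟨c, h, d, h', h''⟩ => ⟨d, ⟨c, h, h'⟩, h''⟩,
      fun ⟨d, ⟨c, h, h'⟩, h''⟩ => ⟨c, h, d, h', h''⟩⟩
  comp_sup _ _ _ := by
    ext a b
    simp only [Pi.sup_apply, sup_Prop_eq, or_and_right, exists_or]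
  comp_one' _ := by ext a b; simp
  conv_conv _ := rfl
  conv_sup _ _ := rfl
  conv_comp _ _ := by ext a b; simp only [and_comm]
  peirce _ _ := fun _ _ ⟨_, h, h'⟩ hy => h' ⟨_, h, hy⟩

/-- The product of a family of relation algebras. -/
def RelAlgebra.pi {K : Type*} {B : K → Type*} [∀ k, BooleanAlgebra (B k)]
    (S : ∀ k, RelAlgebra (B k)) : RelAlgebra (∀ k, B k) where
  comp x y k := (S k).comp (x k) (y k)
  conv x k := (S k).conv (x k)
  one' k := (S k).one'
  comp_assoc _ _ _ := funext fun k => (S k).comp_assoc _ _ _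
  comp_sup _ _ _ := funext fun k => (S k).comp_sup _ _ _
  comp_one' _ := funext fun k => (S k).comp_one' _
  conv_conv _ := funext fun k => (S k).conv_conv _
  conv_sup _ _ := funext fun k => (S k).conv_sup _ _
  conv_comp _ _ := funext fun k => (S k).conv_comp _ _
  peirce _ _ := fun k => (S k).peirce _ _

namespace RAHom

variable {A B : Type*} [BooleanAlgebra A] [BooleanAlgebra B] {R : RelAlgebra A} {S : RelAlgebra B}

theorem mono (f : RAHom R S) {x y : A} (h : x ≤ y) : f.toFun x ≤ f.toFun y := by
  rw [← sup_eq_right, ← f.map_sup, sup_eq_right.2 h]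

theorem map_functional (f : RAHom R S) {x : A} (h : R.Functional x) :
    S.Functional (f.toFun x) := by
  have := f.mono h
  rwa [f.map_comp, f.map_conv, f.map_one'] at this

theorem isQRA (f : RAHom R S) (h : R.IsQRA) : S.IsQRA := by
  obtain ⟨p, q, hp, hq, hpq⟩ := h
  refine ⟨f.toFun p, f.toFun q, f.map_functional hp, f.map_functional hq, ?_⟩
  rw [← f.map_conv, ← f.map_comp, hpq, f.map_top]

theorem injective_of_eq_bot (f : RAHom R S) (h : ∀ x, f.toFun x = ⊥ → x = ⊥) :
    Function.Injective f.toFun := by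
  have aux : ∀ x y, f.toFun x = f.toFun y → x ≤ y := fun x y hxy => by
    rw [← sdiff_eq_bot_iff, sdiff_eq]
    exact h _ (by rw [f.map_inf, f.map_compl, hxy, inf_compl_self])
  exact fun x y hxy => le_antisymm (aux x y hxy) (aux y x hxy.symm)

/-- The homomorphism into a product given by a family of homomorphisms. -/
def pi {K : Type*} {B : K → Type*} [∀ k, BooleanAlgebra (B k)] {S : ∀ k, RelAlgebra (B k)}
    (f : ∀ k, RAHom R (S k)) : RAHom R (RelAlgebra.pi S) where
  toFun x k := (f k).toFun x
  map_sup x y := funext fun k => (f k).map_sup x y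
  map_inf x y := funext fun k => (f k).map_inf x y
  map_compl x := funext fun k => (f k).map_compl x
  map_bot := funext fun k => (f k).map_bot
  map_top := funext fun k => (f k).map_top
  map_comp x y := funext fun k => (f k).map_comp x y
  map_conv x := funext fun k => (f k).map_conv x
  map_one' := funext fun k => (f k).map_one'

end RAHom

/-- An ultrafilter of a Boolean algebra. -/
structure IsBoolUltrafilter {A : Type*} [BooleanAlgebra A] (F : Set A) : Prop where
  mem_of_le : ∀ {x y}, x ≤ y → x ∈ F → y ∈ F
  inf_mem : ∀ {x y}, x ∈ F → y ∈ F → x ⊓ y ∈ F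
  compl_mem_iff : ∀ {x}, xᶜ ∈ F ↔ x ∉ F

namespace IsBoolUltrafilter

variable {A : Type*} [BooleanAlgebra A] {F : Set A}

theorem top_mem (hF : IsBoolUltrafilter F) : ⊤ ∈ F := by
  by_contra h
  exact h (hF.mem_of_le le_top (hF.compl_mem_iff.2 h))

theorem bot_notMem (hF : IsBoolUltrafilter F) : ⊥ ∉ F := by
  rw [← hF.compl_mem_iff, compl_bot]
  exact hF.top_mem

theorem sup_mem_iff (hF : IsBoolUltrafilter F) {x y : A} : x ⊔ y ∈ F ↔ x ∈ F ∨ y ∈ F := by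
  refine ⟨fun h => ?_, fun h => h.elim (hF.mem_of_le le_sup_left) (hF.mem_of_le le_sup_right)⟩
  by_contra! h'
  have := hF.inf_mem h (hF.inf_mem (hF.compl_mem_iff.2 h'.1) (hF.compl_mem_iff.2 h'.2))
  rw [← compl_sup, inf_compl_self] at this
  exact hF.bot_notMem this

theorem exists_of_infClosed {X Y : Set A} (hX : InfClosed X) (hY : InfClosed Y)
    (hX' : X.Nonempty) (hY' : Y.Nonempty) (h : ∀ x ∈ X, ∀ y ∈ Y, x ⊓ y ≠ ⊥) :
    ∃ F : Set A, IsBoolUltrafilter F ∧ X ⊆ F ∧ Y ⊆ F := by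
  obtain ⟨x₀, hx₀⟩ := hX'
  obtain ⟨y₀, hy₀⟩ := hY'
  have hG : Order.IsPFilter {a | ∃ x ∈ X, ∃ y ∈ Y, x ⊓ y ≤ a} := by
    refine .of_def ⟨_, x₀, hx₀, y₀, hy₀, le_rfl⟩ ?_ ?_
    · rintro a ⟨x, hx, y, hy, ha⟩ b ⟨x', hx', y', hy', hb⟩
      refine ⟨a ⊓ b, ⟨_, hX hx hx', _, hY hy hy', ?_⟩, inf_le_left, inf_le_right⟩
      rw [inf_inf_inf_comm]
      exact inf_le_inf ha hb
    · rintro a b hab ⟨x, hx, y, hy, ha⟩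
      exact ⟨x, hx, y, hy, ha.trans hab⟩
  obtain ⟨J, hJ, -, hGJ⟩ := DistribLattice.prime_ideal_of_disjoint_filter_ideal
    (F := hG.toPFilter) (I := Order.Ideal.principal (⊥ : A)) (by
      rw [Set.disjoint_left]
      rintro a ⟨x, hx, y, hy, ha⟩ ha'
      exact h x hx y hy (le_bot_iff.1 (ha.trans ha')))
  rw [Set.disjoint_left] at hGJ
  refine ⟨(J : Set A)ᶜ, ⟨fun hxy hx hy => hx (J.lower hxy hy), fun hx hy hxy =>
    (hJ.mem_or_mem hxy).elim hx hy, fun {x} => ?_⟩, fun x hx => hGJ ⟨x, hx, y₀, hy₀, inf_le_left⟩,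
    fun y hy => hGJ ⟨x₀, hx₀, y, hy, inf_le_right⟩⟩
  simp only [Set.mem_compl_iff, SetLike.mem_coe, not_not]
  refine ⟨fun hx => hJ.mem_or_compl_mem.resolve_right hx, fun hx hx' => ?_⟩
  have := J.sup_mem hx hx'
  rw [sup_compl_eq_top] at this
  exact hJ.toIsProper.top_notMem this

end IsBoolUltrafilter

theorem RelAlgebra.Functional.comp_mem_iff {A : Type*} [BooleanAlgebra A] {R : RelAlgebra A}
    {p : A} (hp : R.Functional p) {F F' : Set A} (hF : IsBoolUltrafilter F)
    (hF' : IsBoolUltrafilter F') (h : ∀ a ∈ F, R.comp p a ∈ F') {a : A} :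
    R.comp p a ∈ F' ↔ a ∈ F := by
  refine ⟨fun ha => ?_, h a⟩
  by_contra ha'
  have := hF'.inf_mem ha (h _ (hF.compl_mem_iff.2 ha'))
  rw [← hp.comp_inf, inf_compl_self, R.comp_bot] at this
  exact hF'.bot_notMem this

section JointType

variable {A₀ : Type u} [BooleanAlgebra A₀] {R₀ : RelAlgebra A₀} {ι : Type} {A : ι → Type u}
  [∀ i, BooleanAlgebra (A i)] {R : ∀ i, RelAlgebra (A i)}

/-- A choice of ultrafilters in a family of extensions of `A₀` that agree on `A₀`. -/
structure JointType (f : ∀ i, RAHom R₀ (R i)) where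
  base : Set A₀
  type : ∀ i, Set (A i)
  base_ult : IsBoolUltrafilter base
  type_ult : ∀ i, IsBoolUltrafilter (type i)
  map_mem : ∀ i, ∀ z ∈ base, (f i).toFun z ∈ type i

variable {f : ∀ i, RAHom R₀ (R i)}

theorem JointType.map_mem_iff (T : JointType f) {i : ι} {z : A₀} :
    (f i).toFun z ∈ T.type i ↔ z ∈ T.base := by
  refine ⟨fun h => ?_, T.map_mem i z⟩
  by_contra hz
  have := T.map_mem i _ (T.base_ult.compl_mem_iff.2 hz)
  rw [(f i).map_compl, (T.type_ult i).compl_mem_iff] at this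
  exact this h

theorem exists_jointType {G : Set A₀} (hG : IsBoolUltrafilter G) (c : ∀ i, A i)
    (hc : ∀ i, ∀ z ∈ G, (f i).toFun z ⊓ c i ≠ ⊥) :
    ∃ T : JointType f, T.base = G ∧ ∀ i, c i ∈ T.type i := by
  have key : ∀ i, ∃ F : Set (A i), IsBoolUltrafilter F ∧ (f i).toFun '' G ⊆ F ∧ {c i} ⊆ F := by
    refine fun i => IsBoolUltrafilter.exists_of_infClosed ?_ infClosed_singleton
      ⟨_, _, hG.top_mem, rfl⟩ (Set.singleton_nonempty _) ?_
    · rintro _ ⟨z, hz, rfl⟩ _ ⟨w, hw, rfl⟩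
      exact ⟨z ⊓ w, hG.inf_mem hz hw, (f i).map_inf z w⟩
    · rintro _ ⟨z, hz, rfl⟩ _ rfl
      exact hc i z hz
  choose F hF hGF hcF using key
  exact ⟨⟨G, F, hG, hF, fun i z hz => hGF i ⟨z, hz, rfl⟩⟩, rfl, fun i => hcF i rfl⟩

/-- Given the joint type of a point `u` with a `t`-successor in one of the algebras, there is a
joint type of a point `u'` whose first projection is `u` and whose second projection is such a
successor. -/
theorem JointType.exists_extend {p q : A₀} (hp : R₀.Functional p)
    (hpq : R₀.comp (R₀.conv p) q = ⊤) (T : JointType f) (i : ι) (t : A i)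
    (ht : (R i).comp t ⊤ ∈ T.type i) :
    ∃ T' : JointType f, (∀ j, ∀ a ∈ T.type j, (R j).comp ((f j).toFun p) a ∈ T'.type j) ∧
      (R i).comp ((R i).comp ((f i).toFun p) t ⊓ (f i).toFun q) ⊤ ∈ T'.type i := by
  have hp' : ∀ j, (R j).Functional ((f j).toFun p) := fun j => (f j).map_functional hp
  have hclosed : ∀ j, InfClosed ((R j).comp ((f j).toFun p) '' T.type j) := by
    rintro j _ ⟨a, ha, rfl⟩ _ ⟨b, hb, rfl⟩
    exact ⟨a ⊓ b, (T.type_ult j).inf_mem ha hb, (hp' j).comp_inf a b⟩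
  have hne : ∀ j, ((R j).comp ((f j).toFun p) '' T.type j).Nonempty :=
    fun j => ⟨_, _, (T.type_ult j).top_mem, rfl⟩
  obtain ⟨E, hE, hEp, hEt⟩ := IsBoolUltrafilter.exists_of_infClosed (hclosed i)
    (infClosed_singleton
      (a := (R i).comp ((R i).comp ((f i).toFun p) t ⊓ (f i).toFun q) ⊤)) (hne i)
    (Set.singleton_nonempty _) (by
      rintro _ ⟨a, ha, rfl⟩ _ rfl h
      have h1 := (R i).comp_inf_eq_bot h
      have h2 : (R i).comp t ⊤ ≤ (R i).comp ((R i).conv ((f i).toFun p))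
          ((R i).comp ((R i).comp ((f i).toFun p) t ⊓ (f i).toFun q) ⊤) := by
        rw [(R i).comp_assoc]
        refine (R i).comp_mono ((R i).conv_comp_rel_le _ _ t ?_) le_rfl
        rw [← (f i).map_conv, ← (f i).map_comp, hpq, (f i).map_top]
      have h3 := (T.type_ult i).inf_mem ((T.type_ult i).mem_of_le h2 ht) ha
      rw [h1] at h3
      exact (T.type_ult i).bot_notMem h3)
  have hG : IsBoolUltrafilter {z | (f i).toFun z ∈ E} := by
    refine ⟨fun hxy hx => hE.mem_of_le ((f i).mono hxy) hx, fun {x y} hx hy => ?_, fun {x} => ?_⟩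
    · rw [Set.mem_ofPred_eq, (f i).map_inf]
      exact hE.inf_mem hx hy
    · rw [Set.mem_ofPred_eq, (f i).map_compl]
      exact hE.compl_mem_iff
  have key : ∀ j, ∃ F : Set (A j), IsBoolUltrafilter F ∧
      (R j).comp ((f j).toFun p) '' T.type j ⊆ F ∧
      (f j).toFun '' {z | (f i).toFun z ∈ E} ⊆ F := by
    refine fun j => IsBoolUltrafilter.exists_of_infClosed (hclosed j) ?_ (hne j)
      ⟨_, _, hG.top_mem, rfl⟩ ?_
    · rintro _ ⟨z, hz, rfl⟩ _ ⟨w, hw, rfl⟩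
      exact ⟨z ⊓ w, hG.inf_mem hz hw, (f j).map_inf z w⟩
    · rintro _ ⟨a, ha, rfl⟩ _ ⟨z, hz, rfl⟩ h
      have h1 := (R j).comp_inf_eq_bot h
      rw [← (f j).map_conv, ← (f j).map_comp] at h1
      have h2 : R₀.comp (R₀.conv p) z ∈ T.base := by
        rw [← T.map_mem_iff (i := i), ← (hp' i).comp_mem_iff (T.type_ult i) hE
          fun a ha => hEp ⟨a, ha, rfl⟩]
        refine hE.mem_of_le ?_ (hE.inf_mem (hEp ⟨_, (T.type_ult i).top_mem, rfl⟩) hz)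
        refine ((R i).comp_inf_le_left _ _ _).trans ((R i).comp_mono le_rfl ?_)
        rw [top_inf_eq, (f i).map_comp, (f i).map_conv]
      have h3 := (T.type_ult j).inf_mem (T.map_mem j _ h2) ha
      rw [h1] at h3
      exact (T.type_ult j).bot_notMem h3
  classical
  choose F hF hpF hGF using key
  refine ⟨⟨_, Function.update F i E, hG, fun j => ?_, fun j z hz => ?_⟩, fun j a ha => ?_, ?_⟩
  · obtain rfl | hj := eq_or_ne j i
    · rwa [Function.update_self]
    · rw [Function.update_of_ne hj]
      exact hF j
  · obtain rfl | hj := eq_or_ne j i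
    · rwa [Function.update_self]
    · rw [Function.update_of_ne hj]
      exact hGF j ⟨z, hz, rfl⟩
  · obtain rfl | hj := eq_or_ne j i
    · simp only [Function.update_self]
      exact hEp ⟨a, ha, rfl⟩
    · simp only [Function.update_of_ne hj]
      exact hpF j ⟨a, ha, rfl⟩
  · simp only [Function.update_self]
    exact hEt rfl

end JointType

/-- A map from `A` to binary relations on `U` with all properties of a homomorphism, except that
compositions need not be witnessed and `1'` is only reflexive. -/
structure RelAlgebra.IsLabelling {A U : Type*} [BooleanAlgebra A] (R : RelAlgebra A)
    (l : A → U → U → Prop) : Prop where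
  sup : ∀ {x y a b}, l (x ⊔ y) a b ↔ l x a b ∨ l y a b
  compl : ∀ {x a b}, l xᶜ a b ↔ ¬ l x a b
  conv : ∀ {x a b}, l x a b → l (R.conv x) b a
  comp : ∀ {x y a b c}, l x a b → l y b c → l (R.comp x y) a c
  one' : ∀ a, l R.one' a a

theorem RelAlgebra.IsLabelling.equivalence {A U : Type*} [BooleanAlgebra A] {R : RelAlgebra A}
    {l : A → U → U → Prop} (hl : R.IsLabelling l) : Equivalence (l R.one') where
  refl := hl.one'
  symm h := by simpa only [R.conv_one'] using hl.conv h
  trans h h' := by simpa only [R.comp_one'] using hl.comp h h'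

theorem RelAlgebra.IsLabelling.exists_hom {A U : Type*} [BooleanAlgebra A] {R : RelAlgebra A}
    {l : A → U → U → Prop} (hl : R.IsLabelling l)
    (hw : ∀ {x y a c}, l (R.comp x y) a c → ∃ b, l x a b ∧ l y b c) (s : Setoid U)
    (hs : ∀ a b, s a b ↔ l R.one' a b) :
    ∃ m : RAHom R (RelAlgebra.full (Quotient s)),
      ∀ x a b, m.toFun x (Quotient.mk s a) (Quotient.mk s b) ↔ l x a b := by
  have aux : ∀ x a b a' b', s a a' → s b b' → l x a b → l x a' b' := fun x a b a' b' ha hb h => by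
    have := hl.comp (hl.comp ((hs _ _).1 (s.symm ha)) h) ((hs _ _).1 hb)
    rwa [R.one'_comp, R.comp_one'] at this
  let m : A → Quotient s → Quotient s → Prop := fun x => Quotient.lift₂ (l x)
    fun a b a' b' ha hb => propext
      ⟨aux x a b a' b' ha hb, aux x a' b' a b (s.symm ha) (s.symm hb)⟩
  have ext : ∀ r r' : Quotient s → Quotient s → Prop,
      (∀ a b : U, r (Quotient.mk s a) (Quotient.mk s b) ↔ r' (Quotient.mk s a) (Quotient.mk s b)) →
      r = r' := fun r r' h => by
    ext a b
    exact Quotient.inductionOn₂ a b h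
  have msup : ∀ x y, m (x ⊔ y) = m x ⊔ m y := fun x y => ext _ _ fun a b => hl.sup
  have mcompl : ∀ x, m xᶜ = (m x)ᶜ := fun x => ext _ _ fun a b => hl.compl
  have minf : ∀ x y, m (x ⊓ y) = m x ⊓ m y := fun x y => by
    rw [← compl_compl (x ⊓ y), compl_inf, mcompl, msup, mcompl, mcompl, compl_sup, compl_compl,
      compl_compl]
  refine ⟨⟨m, msup, minf, mcompl, ?_, ?_, fun x y => ext _ _ fun a b => ⟨fun h => ?_, ?_⟩,
    fun x => ext _ _ fun a b => ⟨fun h => ?_, hl.conv⟩, ext _ _ fun a b => ?_⟩,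
    fun x a b => Iff.rfl⟩
  · rw [← inf_compl_self ⊤, minf, mcompl, inf_compl_self]
  · rw [← sup_compl_eq_top (x := ⊤), msup, mcompl, sup_compl_eq_top]
  · obtain ⟨c, h, h'⟩ := hw h
    exact ⟨Quotient.mk s c, h, h'⟩
  · rintro ⟨c, h, h'⟩
    induction c using Quotient.inductionOn with
    | h c => exact hl.comp h h'
  · have := hl.conv h
    rwa [R.conv_conv] at this
  · exact (hs a b).symm.trans (Quotient.eq (r := s)).symm

theorem RelAlgebra.isLabelling_rel {A U : Type*} [BooleanAlgebra A] (R : RelAlgebra A) {F : Set A}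
    (hF : IsBoolUltrafilter F) {g : U → A} (hg : ∀ a, R.Functional (g a))
    (hdom : ∀ a, R.comp (g a) ⊤ ∈ F) : R.IsLabelling fun r a b => R.rel (g a) (g b) r ∈ F where
  sup := by
    intro x y a b
    rw [R.rel_sup, hF.sup_mem_iff]
  compl := by
    intro x a b
    refine ⟨fun h h' => hF.bot_notMem ?_, fun h => ?_⟩
    · rw [← R.rel_inf_rel_compl (hg a) (hg b) x]
      exact hF.inf_mem h' h
    · refine (hF.sup_mem_iff.1 ?_).resolve_left h
      rw [← R.rel_sup, sup_compl_eq_top]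
      exact hF.mem_of_le (R.le_rel_top _ _) (hF.inf_mem (hdom a) (hdom b))
  conv h := hF.mem_of_le (R.rel_conv_le _ _ _) h
  comp h h' := hF.mem_of_le (R.rel_inf_rel_le _ (hg _) _ _ _) (hF.inf_mem h h')
  one' a := by
    rw [R.rel_one']
    exact hdom a

/-- The points of the model: two initial points, and for all points `j`, `k` and all elements `r`,
`s` of the algebra with index `i` a witness for `j` and `k` being related by `r ; s`. -/
inductive HenkinPoint {ι : Type} (A : ι → Type u) : Type u
  | left
  | right
  | wit (i : ι) (j k : HenkinPoint A) (r s : A i)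

namespace HenkinPoint

variable {ι : Type} {A : ι → Type u}

/-- The nesting depth of a point. -/
def depth : HenkinPoint A → ℕ
  | left => 0
  | right => 0
  | wit _ j k _ _ => max j.depth k.depth + 1

open Classical in
/-- The quasi-projection that computes a point from a code of the initial points and the points in
the list. -/
noncomputable def name {A₀ : Type*} [BooleanAlgebra A₀] (R₀ : RelAlgebra A₀) (p q : A₀) :
    List (HenkinPoint A) → HenkinPoint A → A₀
  | [], j => if j = left then p else q
  | P :: L, j => if j = P then q else R₀.comp p (name R₀ p q L j)

theorem functional_name {A₀ : Type*} [BooleanAlgebra A₀] {R₀ : RelAlgebra A₀} {p q : A₀}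
    (hp : R₀.Functional p) (hq : R₀.Functional q) (L : List (HenkinPoint A)) (j : HenkinPoint A) :
    R₀.Functional (name R₀ p q L j) := by
  induction L with
  | nil => unfold name; split_ifs <;> assumption
  | cons P L ih =>
    unfold name
    split_ifs
    exacts [hq, hp.comp ih]

/-- An order in which points can be added to a structure, the last one first. -/
def AddedAfter (P Q : HenkinPoint A) : Prop := P ≠ Q ∧ Q.depth ≤ P.depth

theorem exists_list (S : Finset (HenkinPoint A)) :
    ∃ L : List (HenkinPoint A), L.Pairwise AddedAfter ∧ (∀ P ∈ L, 0 < P.depth) ∧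
      ∀ P ∈ S, 0 < P.depth → P ∈ L := by
  classical
  let r : HenkinPoint A → HenkinPoint A → Prop := fun P Q => Q.depth ≤ P.depth
  have : Std.Total r := ⟨fun P Q => le_total _ _⟩
  have : IsTrans _ r := ⟨fun P Q T h h' => le_trans h' h⟩
  have hperm := List.perm_insertionSort r (S.filter fun P => 0 < P.depth).toList
  refine ⟨_, ((hperm.nodup_iff.2 (Finset.nodup_toList _)).and
    (List.pairwise_insertionSort r (S.filter fun P => 0 < P.depth).toList)), ?_, ?_⟩
  · intro P hP
    simpa using (Finset.mem_filter.1 (Finset.mem_toList.1 (hperm.mem_iff.1 hP))).2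
  · intro P hP hP'
    exact hperm.mem_iff.2 (Finset.mem_toList.2 (Finset.mem_filter.2 ⟨hP, hP'⟩))

end HenkinPoint

section Model

open HenkinPoint

variable {A₀ : Type u} [BooleanAlgebra A₀] {R₀ : RelAlgebra A₀} {ι : Type} {A : ι → Type u}
  [∀ i, BooleanAlgebra (A i)] {R : ∀ i, RelAlgebra (A i)} {f : ∀ i, RAHom R₀ (R i)}

/-- The labelling of points by the relations that hold between them if a code of the initial
points and the points in `L` has joint type `T`. -/
def JointType.label (T : JointType f) (p q : A₀) (L : List (HenkinPoint A)) (i : ι) (r : A i)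
    (j k : HenkinPoint A) : Prop :=
  (R i).rel ((f i).toFun (name R₀ p q L j)) ((f i).toFun (name R₀ p q L k)) r ∈ T.type i

theorem exists_jointType_list {p q : A₀} (hp : R₀.Functional p) (hq : R₀.Functional q)
    (hpq : R₀.comp (R₀.conv p) q = ⊤) (T₀ : JointType f) (x : ∀ i, A i) (i₀ : ι)
    (hT₀ : ∀ i, (R i).rel ((f i).toFun p) ((f i).toFun q) (x i) ∈ T₀.type i)
    (L : List (HenkinPoint A)) (hL : L.Pairwise AddedAfter) (hL' : ∀ P ∈ L, 0 < P.depth) :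
    ∃ T : JointType f, (∀ j, R₀.comp (name R₀ p q L j) ⊤ ∈ T.base) ∧
      (∀ i, T.label p q L i (x i) left right) ∧
      ∀ i j k r s, wit i j k r s ∈ L → T.label p q L i ((R i).comp r s) j k →
        T.label p q L i r j (wit i j k r s) ∧ T.label p q L i s (wit i j k r s) k := by
  induction L with
  | nil =>
    refine ⟨T₀, fun j => ?_, fun i => ?_, by simp⟩
    · rw [← T₀.map_mem_iff (i := i₀), (f i₀).map_comp, (f i₀).map_top]
      unfold name
      split_ifs
      · refine (T₀.type_ult i₀).mem_of_le ?_
          ((T₀.type_ult i₀).mem_of_le ((R i₀).rel_conv_le _ _ _) (hT₀ i₀))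
        exact (R i₀).comp_mono inf_le_right le_rfl
      · exact (T₀.type_ult i₀).mem_of_le ((R i₀).comp_mono inf_le_right le_rfl) (hT₀ i₀)
    · simpa [JointType.label, name] using hT₀ i
  | cons Q L ih =>
    rw [List.pairwise_cons] at hL
    obtain ⟨T, hdom, hx, hwit⟩ := ih hL.2 fun P hP => hL' P (List.mem_cons_of_mem _ hP)
    have hQ := hL' Q List.mem_cons_self
    obtain ⟨i, j, k, r, s, rfl⟩ : ∃ i j k r s, Q = wit i j k r s := by
      cases Q with
      | left => simp [depth] at hQ
      | right => simp [depth] at hQ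
      | wit i j k r s => exact ⟨i, j, k, r, s, rfl⟩
    set Q := wit i j k r s
    -- the point `Q` is added as a `t`-successor of the old code
    obtain ⟨t, ht, htw⟩ : ∃ t : A i, (R i).comp t ⊤ ∈ T.type i ∧
        (T.label p q L i ((R i).comp r s) j k →
          t = (R i).comp ((f i).toFun (name R₀ p q L j)) r ⊓
            (R i).comp ((f i).toFun (name R₀ p q L k)) ((R i).conv s)) := by
      by_cases h : T.label p q L i ((R i).comp r s) j k
      · exact ⟨_, (T.type_ult i).mem_of_le ((R i).rel_comp_le _ _ _ _) h, fun _ => rfl⟩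
      · refine ⟨⊤, ?_, fun h' => (h h').elim⟩
        rw [(R i).top_comp_top]
        exact (T.type_ult i).top_mem
    obtain ⟨T', hT', htT'⟩ := T.exists_extend hp hpq i t ht
    have name_self : name R₀ p q (Q :: L) Q = q := if_pos rfl
    have name_of_ne : ∀ {P}, P ≠ Q → name R₀ p q (Q :: L) P = R₀.comp p (name R₀ p q L P) :=
      fun h => if_neg h
    have label_iff : ∀ {i' r' P P'}, P ≠ Q → P' ≠ Q →
        (T'.label p q (Q :: L) i' r' P P' ↔ T.label p q L i' r' P P') := fun {i' _ _ _} h h' => by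
      have hp' := (f i').map_functional hp
      unfold JointType.label
      rw [name_of_ne h, name_of_ne h', (f i').map_comp, (f i').map_comp,
        (R i').rel_comp_comp hp', hp'.comp_mem_iff (T.type_ult i') (T'.type_ult i') (hT' i')]
    have hdom' : ∀ j, R₀.comp (name R₀ p q (Q :: L) j) ⊤ ∈ T'.base := fun P => by
      rw [← T'.map_mem_iff (i := i), (f i).map_comp, (f i).map_top]
      by_cases h : P = Q
      · rw [h, name_self]
        exact (T'.type_ult i).mem_of_le ((R i).comp_mono inf_le_right le_rfl) htT'
      · rw [name_of_ne h, (f i).map_comp, ← (R i).comp_assoc]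
        refine hT' i _ ?_
        rw [← (f i).map_top, ← (f i).map_comp, T.map_mem_iff]
        exact hdom P
    have ne_of_depth : ∀ {P : HenkinPoint A}, P.depth < Q.depth → P ≠ Q := by
      rintro _ h rfl
      exact h.false
    refine ⟨T', hdom', fun i' => ?_, fun i' j' k' r' s' hP h => ?_⟩
    · exact (label_iff (ne_of_depth (P := left) hQ) (ne_of_depth (P := right) hQ)).2 (hx i')
    have hdepth : (wit i' j' k' r' s').depth ≤ Q.depth := by
      rcases List.mem_cons.1 hP with h | h
      · rw [h]
      · exact (hL.1 _ h).2
    have hj' : j' ≠ Q := ne_of_depth (by simp only [depth] at hdepth ⊢; omega)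
    have hk' : k' ≠ Q := ne_of_depth (by simp only [depth] at hdepth ⊢; omega)
    rw [label_iff hj' hk'] at h
    by_cases hPQ : wit i' j' k' r' s' = Q
    · have hPQ' := hPQ
      injection hPQ' with hi hj hk hr hs
      subst hi hj hk
      obtain rfl := eq_of_heq hr
      obtain rfl := eq_of_heq hs
      rw [htw h] at htT'
      have hlab : ∀ {r' P}, P ≠ Q → t ≤ (R i').comp ((f i').toFun (name R₀ p q L P)) r' →
          T'.label p q (Q :: L) i' r' P Q := by
        intro r' P hP ht'
        unfold JointType.label
        rw [name_self, name_of_ne hP, (f i').map_comp]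
        refine (T'.type_ult i').mem_of_le ((R i').comp_mono (inf_le_inf_right _ ?_) le_rfl) htT'
        rw [← (R i').comp_assoc, ← htw h]
        exact (R i').comp_mono le_rfl ht'
      have hlabelling := (R i').isLabelling_rel (T'.type_ult i')
        (g := fun P => (f i').toFun (name R₀ p q (Q :: L) P))
        (fun P => (f i').map_functional (functional_name hp hq _ P))
        (fun P => by
          rw [← (f i').map_top, ← (f i').map_comp, T'.map_mem_iff]
          exact hdom' P)
      refine ⟨hlab hj' (by rw [htw h]; exact inf_le_left), ?_⟩
      have := hlabelling.conv (hlab hk' (by rw [htw h]; exact inf_le_right))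
      rwa [(R i').conv_conv] at this
    · rw [label_iff hj' hPQ, label_iff hPQ hk']
      exact hwit i' j' k' r' s' ((List.mem_cons.1 hP).resolve_left hPQ) h

open Filter in
theorem exists_joint_representation {p q : A₀} (hp : R₀.Functional p) (hq : R₀.Functional q)
    (hpq : R₀.comp (R₀.conv p) q = ⊤) (T₀ : JointType f) (x : ∀ i, A i) (i₀ : ι)
    (hT₀ : ∀ i, (R i).rel ((f i).toFun p) ((f i).toFun q) (x i) ∈ T₀.type i) :
    ∃ (U : Type u) (m : ∀ i, RAHom (R i) (RelAlgebra.full U)),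
      (∀ i i' z, (m i).toFun ((f i).toFun z) = (m i').toFun ((f i').toFun z)) ∧
      ∃ u v, ∀ i, (m i).toFun (x i) u v := by
  have key : ∀ S : Finset (HenkinPoint A), ∃ l : ∀ i, A i → HenkinPoint A → HenkinPoint A → Prop,
      (∀ i, (R i).IsLabelling (l i)) ∧
      (∀ i i' z j k, l i ((f i).toFun z) j k ↔ l i' ((f i').toFun z) j k) ∧
      (∀ i, l i (x i) left right) ∧
      ∀ i j k r s, wit i j k r s ∈ S → l i ((R i).comp r s) j k →
        l i r j (wit i j k r s) ∧ l i s (wit i j k r s) k := fun S => by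
    obtain ⟨L, hL, hL', hSL⟩ := exists_list S
    obtain ⟨T, hdom, hx, hwit⟩ := exists_jointType_list hp hq hpq T₀ x i₀ hT₀ L hL hL'
    refine ⟨fun i => T.label p q L i, fun i => (R i).isLabelling_rel (T.type_ult i)
      (g := fun P => (f i).toFun (name R₀ p q L P))
      (fun P => (f i).map_functional (functional_name hp hq _ P)) (fun P => ?_), ?_, hx,
      fun i j k r s h => hwit i j k r s (hSL _ h (Nat.succ_pos _))⟩
    · rw [← (f i).map_top, ← (f i).map_comp, T.map_mem_iff]
      exact hdom P
    · have : ∀ i z j k, T.label p q L i ((f i).toFun z) j k ↔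
          R₀.rel (name R₀ p q L j) (name R₀ p q L k) z ∈ T.base := fun i z j k => by
        rw [← T.map_mem_iff (i := i)]
        simp only [JointType.label, RelAlgebra.rel, (f i).map_comp, (f i).map_inf, (f i).map_top]
      intro i i' z j k
      exact (this i z j k).trans (this i' z j k).symm
  choose l hl hagree hx hwit using key
  let F : Ultrafilter (Finset (HenkinPoint A)) := Ultrafilter.of atTop
  have hF : (F : Filter (Finset (HenkinPoint A))) ≤ atTop := Ultrafilter.of_le _
  let l' : ∀ i, A i → HenkinPoint A → HenkinPoint A → Prop :=
    fun i r j k => ∀ᶠ S in F, l S i r j k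
  have hl' : ∀ i, (R i).IsLabelling (l' i) := fun i =>
    { sup := by
        intro y z j k
        rw [← Ultrafilter.eventually_or]
        exact eventually_congr (.of_forall fun S => (hl S i).sup)
      compl := by
        intro y j k
        rw [← Ultrafilter.eventually_not]
        exact eventually_congr (.of_forall fun S => (hl S i).compl)
      conv := fun h => h.mono fun S h => (hl S i).conv h
      comp := fun h h' => h.mp (h'.mono fun S h' h => (hl S i).comp h h')
      one' := fun j => .of_forall fun S => (hl S i).one' j }
  have hagree' : ∀ i i' z j k, l' i ((f i).toFun z) j k ↔ l' i' ((f i').toFun z) j k :=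
    fun i i' z j k => eventually_congr (.of_forall fun S => hagree S i i' z j k)
  have hwit' : ∀ i {r s j k}, l' i ((R i).comp r s) j k → ∃ P, l' i r j P ∧ l' i s P k := by
    intro i r s j k h
    have hmem : ∀ᶠ S in (F : Filter (Finset (HenkinPoint A))), wit i j k r s ∈ S :=
      hF ((eventually_ge_atTop {wit i j k r s}).mono fun S hS => hS (Finset.mem_singleton_self _))
    have := h.mp (hmem.mono fun S hS h => hwit S i j k r s hS h)
    exact ⟨_, eventually_and.1 this⟩
  let st : Setoid (HenkinPoint A) := ⟨l' i₀ (R i₀).one', (hl' i₀).equivalence⟩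
  have hm := fun i => (hl' i).exists_hom (hwit' i) st fun j k => by
    rw [← (f i).map_one', hagree' i i₀, (f i₀).map_one']
    rfl
  choose m hm using hm
  refine ⟨Quotient st, m, fun i i' z => ?_, Quotient.mk st left, Quotient.mk st right,
    fun i => (hm i _ _ _).2 (.of_forall fun S => hx S i)⟩
  ext a b
  induction a, b using Quotient.inductionOn₂ with
  | h a b => rw [hm, hm, hagree' i i']

end Model

/-- Elements without interpolant are separated by a joint representation. -/
theorem exists_joint_representation_of_not_interpolable {A₀ A₁ A₂ : Type u}
    [BooleanAlgebra A₀] [BooleanAlgebra A₁] [BooleanAlgebra A₂]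
    {R₀ : RelAlgebra A₀} {R₁ : RelAlgebra A₁} {R₂ : RelAlgebra A₂} (h₀ : R₀.IsQRA)
    (f₁ : RAHom R₀ R₁) (f₂ : RAHom R₀ R₂) (x : A₁) (y : A₂)
    (hxy : ¬∃ z : A₀, x ≤ f₁.toFun z ∧ f₂.toFun z ≤ y) :
    ∃ (U : Type u) (m₁ : RAHom R₁ (RelAlgebra.full U)) (m₂ : RAHom R₂ (RelAlgebra.full U)),
      (∀ z, m₁.toFun (f₁.toFun z) = m₂.toFun (f₂.toFun z)) ∧ ¬ m₁.toFun x ≤ m₂.toFun y := by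
  obtain ⟨p, q, hp, hq, hpq⟩ := h₀
  set X := R₁.rel (f₁.toFun p) (f₁.toFun q) x with hX
  set Y := R₂.rel (f₂.toFun p) (f₂.toFun q) yᶜ with hY
  -- an interpolant of the domains `X` and `Yᶜ` would yield one of `x` and `y`
  have hXY : ∀ z, X ≤ f₁.toFun z → Y ⊓ f₂.toFun z ≠ ⊥ := by
    intro z hz hzY
    refine hxy ⟨R₀.comp (R₀.conv p) (R₀.comp p ⊤ ⊓ q ⊓ z), ?_, ?_⟩
    · refine (R₁.conv_comp_rel_le (f₁.toFun p) (f₁.toFun q) x ?_).trans ?_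
      · rw [← f₁.map_conv, ← f₁.map_comp, hpq, f₁.map_top]
      · rw [f₁.map_comp, f₁.map_conv, f₁.map_inf, f₁.map_inf, f₁.map_comp, f₁.map_top]
        exact R₁.comp_mono le_rfl (le_inf (inf_le_inf_right _ (R₁.comp_mono le_rfl le_top))
          ((R₁.le_comp_top _).trans hz))
    · rw [f₂.map_comp, f₂.map_conv, f₂.map_inf, f₂.map_inf, f₂.map_comp, f₂.map_top]
      refine le_trans (R₂.comp_mono le_rfl ?_) ((f₂.map_functional hp).conv_comp_comp_le y)
      rw [← sup_compl_eq_top (x := y), R₂.comp_sup_right, inf_sup_right, inf_sup_right]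
      refine sup_le (inf_le_left.trans inf_le_left) ?_
      refine (inf_le_inf_right _ (R₂.le_comp_top _)).trans ?_
      exact hzY.le.trans bot_le
  obtain ⟨G, hG, hGX, hGY⟩ := IsBoolUltrafilter.exists_of_infClosed
    (X := {z | X ≤ f₁.toFun z}) (Y := {z | Y ≤ f₂.toFun z})
    (fun z hz w hw => by
      rw [Set.mem_ofPred_eq, f₁.map_inf]
      exact le_inf hz hw)
    (fun z hz w hw => by
      rw [Set.mem_ofPred_eq, f₂.map_inf]
      exact le_inf hz hw)
    ⟨⊤, by simp [f₁.map_top]⟩ ⟨⊤, by simp [f₂.map_top]⟩ (fun z hz w hw h => hXY z hz (by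
      refine le_bot_iff.1 ((inf_le_inf_right _ hw).trans ?_)
      rw [← f₂.map_inf, inf_comm, h, f₂.map_bot]))
  have hX' : ∀ z ∈ G, f₁.toFun z ⊓ X ≠ ⊥ := fun z hz h => by
    have : zᶜ ∈ G := hGX (by
      rwa [Set.mem_ofPred_eq, f₁.map_compl, le_compl_iff_disjoint_left, disjoint_iff])
    exact hG.compl_mem_iff.1 this hz
  have hY' : ∀ z ∈ G, f₂.toFun z ⊓ Y ≠ ⊥ := fun z hz h => by
    have : zᶜ ∈ G := hGY (by
      rwa [Set.mem_ofPred_eq, f₂.map_compl, le_compl_iff_disjoint_left, disjoint_iff])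
    exact hG.compl_mem_iff.1 this hz
  let A : Bool → Type u := Bool.rec A₂ A₁
  let instA : ∀ b, BooleanAlgebra (A b) :=
    Bool.rec (inferInstanceAs (BooleanAlgebra A₂)) (inferInstanceAs (BooleanAlgebra A₁))
  let R : ∀ b, @RelAlgebra (A b) (instA b) := Bool.rec R₂ R₁
  let f : ∀ b, @RAHom A₀ (A b) _ (instA b) R₀ (R b) := Bool.rec f₂ f₁
  let c : ∀ b, A b := Bool.rec Y X
  let e : ∀ b, A b := Bool.rec yᶜ x
  obtain ⟨T, -, hT⟩ := @exists_jointType _ _ _ _ A instA R f G hG c (Bool.forall_bool.2 ⟨hY', hX'⟩)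
  obtain ⟨U, m, hm, u, v, huv⟩ := @exists_joint_representation _ _ _ _ A instA R f _ _ hp hq
    hpq T e true (Bool.forall_bool.2 ⟨hT false, hT true⟩)
  refine ⟨U, m true, m false, hm true false, fun h => ?_⟩
  have h1 : ((m false).toFun yᶜ) u v := huv false
  rw [show (m false).toFun yᶜ = ((m false).toFun y)ᶜ from (m false).map_compl y] at h1
  exact h1 (h u v (huv true))
/-- The class `QRA` of quasi-projective relation algebras has
the superamalgamation property. -/
theorem statement13 (A₀ A₁ A₂ : Type u)
    (i₀ : BooleanAlgebra A₀) (i₁ : BooleanAlgebra A₁) (i₂ : BooleanAlgebra A₂)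
    (R₀ : RelAlgebra A₀) (R₁ : RelAlgebra A₁) (R₂ : RelAlgebra A₂)
    (h₀ : R₀.IsQRA) (h₁ : R₁.IsQRA) (h₂ : R₂.IsQRA)
    (f₁ : RAHom R₀ R₁) (f₂ : RAHom R₀ R₂)
    (hf₁ : Function.Injective f₁.toFun) (hf₂ : Function.Injective f₂.toFun) :
    ∃ (D : Type u) (iD : BooleanAlgebra D) (RD : RelAlgebra D), RD.IsQRA ∧
      ∃ (m₁ : RAHom R₁ RD) (m₂ : RAHom R₂ RD),
        Function.Injective m₁.toFun ∧ Function.Injective m₂.toFun ∧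
        (∀ a, m₁.toFun (f₁.toFun a) = m₂.toFun (f₂.toFun a)) ∧
        (∀ (x : A₁) (y : A₂), m₁.toFun x ≤ m₂.toFun y →
          ∃ z : A₀, x ≤ f₁.toFun z ∧ f₂.toFun z ≤ y) ∧
        (∀ (x : A₁) (y : A₂), m₂.toFun y ≤ m₁.toFun x →
          ∃ z : A₀, y ≤ f₂.toFun z ∧ f₁.toFun z ≤ x) := by

  have key := fun k : {k : A₁ × A₂ // ¬∃ z : A₀, k.1 ≤ f₁.toFun z ∧ f₂.toFun z ≤ k.2} =>
    exists_joint_representation_of_not_interpolable h₀ f₁ f₂ k.1.1 k.1.2 k.2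
  choose U n₁ n₂ hagree hsep using key
  let m₁ := RAHom.pi n₁
  let m₂ := RAHom.pi n₂
  have hinter : ∀ (x : A₁) (y : A₂), m₁.toFun x ≤ m₂.toFun y →
      ∃ z : A₀, x ≤ f₁.toFun z ∧ f₂.toFun z ≤ y := fun x y h => by
    by_contra h'
    exact hsep ⟨(x, y), h'⟩ (h ⟨(x, y), h'⟩)
  have hinter' : ∀ (x : A₁) (y : A₂), m₂.toFun y ≤ m₁.toFun x →
      ∃ z : A₀, y ≤ f₂.toFun z ∧ f₁.toFun z ≤ x := fun x y h => by
    obtain ⟨z, hz, hz'⟩ := hinter xᶜ yᶜ (by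
      rw [m₁.map_compl, m₂.map_compl]
      exact compl_le_compl h)
    refine ⟨zᶜ, ?_, ?_⟩
    · rw [f₂.map_compl]
      exact le_compl_comm.1 hz'
    · rw [f₁.map_compl]
      exact compl_le_of_compl_le hz
  refine ⟨_, inferInstance, _, m₁.isQRA h₁, m₁, m₂, m₁.injective_of_eq_bot fun x hx => ?_,
    m₂.injective_of_eq_bot fun y hy => ?_, fun a => funext fun k => hagree k a, hinter, hinter'⟩
  · obtain ⟨z, hz, hz'⟩ := hinter x ⊥ (by rw [hx]; exact bot_le)
    rw [le_bot_iff, ← f₂.map_bot] at hz'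
    rwa [hf₂ hz', f₁.map_bot, le_bot_iff] at hz
  · obtain ⟨z, hz, hz'⟩ := hinter' ⊥ y (by rw [hy]; exact bot_le)
    rw [le_bot_iff, ← f₁.map_bot] at hz'
    rwa [hf₁ hz', f₂.map_bot, le_bot_iff] at hz
end

section
/- Let 𝔪 and 𝔫 be cardinals such that the cardinal sum ∑_{s<𝔪} 𝔫^s, taken over all cardinals s with s < 𝔪, equals 𝔫. Let ι be an index type of cardinality less than 𝔫, and let (a_i)_{i∈ι} be a family of cardinals with a_i < 𝔪 for every i ∈ ι. Then the cardinal sum ∑_{i∈ι} a_i is strictly less than 𝔫. -/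
universe u

/-- Two distinct summands of a cardinal sum are jointly bounded by the sum. -/
theorem Cardinal.add_le_sum_of_ne {ι : Type u} (f : ι → Cardinal.{u}) {i j : ι} (hij : i ≠ j) :
    f i + f j ≤ Cardinal.sum f := by
  classical
  calc f i + f j = Pi.single (M := fun _ => Cardinal.{u}) i (f i) i +
          Pi.single (M := fun _ => Cardinal.{u}) j (f j) j := by simp
    _ ≤ Cardinal.sum (Pi.single i (f i)) + Cardinal.sum (Pi.single j (f j)) :=
        add_le_add (Cardinal.le_sum.{u, u} _ i) (Cardinal.le_sum.{u, u} _ j)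
    _ = Cardinal.sum (Pi.single i (f i) + Pi.single j (f j)) :=
        (Cardinal.sum_add_distrib _ _).symm
    _ ≤ Cardinal.sum f := by
        refine Cardinal.sum_le_sum _ _ fun k => ?_
        rcases eq_or_ne k i with rfl | hki
        · simp [hij]
        · rcases eq_or_ne k j with rfl | hkj
          · simp [hki]
          · simp [hki, hkj]

/-- An infinite cardinal `n` with `n ^ s ≤ n` for all `s < n` is regular. -/
theorem Cardinal.isRegular_of_power_le {n : Cardinal.{u}} (hn : Cardinal.aleph0 ≤ n)
    (h : ∀ s < n, n ^ s ≤ n) : n.IsRegular := by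
  refine ⟨hn, ?_⟩
  by_contra! hcof
  exact (h _ hcof).not_gt (Cardinal.lt_power_cof_ord hn)

/-- Let `𝔪`, `𝔫` be cardinals with `∑_{s < 𝔪} 𝔫 ^ s = 𝔫` (the
sum taken over all cardinals `s < 𝔪`).  If `ι` is an index type of cardinality
less than `𝔫` and `a : ι → Cardinal` is a family of cardinals with `a i < 𝔪` for
each `i`, then `∑ i, a i < 𝔫`. -/
theorem statement16 (m n : Cardinal.{u})
    (h : Cardinal.sum (fun s : Set.Iio m => Cardinal.lift.{u + 1} (n ^ (s : Cardinal.{u}))) =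
      Cardinal.lift.{u + 1} n)
    (ι : Type u) (hι : Cardinal.mk ι < n)
    (a : ι → Cardinal.{u}) (ha : ∀ i, a i < m) :
    Cardinal.sum a < n := by
  have hpow : ∀ s < m, n ^ s ≤ n := fun s hs => by
    rw [← Cardinal.lift_le.{u + 1}, ← h]
    exact Cardinal.le_sum.{u + 1, u + 1}
      (fun s : Set.Iio m => Cardinal.lift.{u + 1} (n ^ (s : Cardinal.{u}))) ⟨s, hs⟩
  rcases le_or_gt m 1 with hm | hm
  · have ha0 : a = fun _ => 0 := by
      funext i
      exact Cardinal.lt_one_iff.mp ((ha i).trans_le hm)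
    simpa [ha0] using (zero_le (a := Cardinal.mk ι)).trans_lt hι
  have hn : Cardinal.aleph0 ≤ n := by
    have hadd := Cardinal.add_le_sum_of_ne
      (fun s : Set.Iio m => Cardinal.lift.{u + 1} (n ^ (s : Cardinal.{u})))
      (i := ⟨0, zero_lt_one.trans hm⟩) (j := ⟨1, hm⟩)
      fun e => zero_ne_one (congrArg Subtype.val e)
    rw [h, ← Cardinal.lift_add, Cardinal.lift_le, Cardinal.power_zero, Cardinal.power_one] at hadd
    by_contra! hfin
    obtain ⟨k, rfl⟩ := Cardinal.lt_aleph0.mp hfin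
    norm_cast at hadd
    omega
  have hmn : m ≤ n := by
    by_contra! hlt
    exact (hpow n hlt).not_gt
      ((Cardinal.cantor' n (Cardinal.one_lt_aleph0.trans_le hn)))
  rcases hmn.lt_or_eq with hlt | rfl
  · calc Cardinal.sum a ≤ Cardinal.sum fun _ : ι => m := Cardinal.sum_le_sum _ _ fun i => (ha i).le
      _ = Cardinal.mk ι * m := Cardinal.sum_const' ι m
      _ < n := Cardinal.mul_lt_of_lt hn hι hlt
  · exact Cardinal.sum_lt_of_isRegular (Cardinal.isRegular_of_power_le hn hpow) hι ha
end

section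
/- For every finite α ≥ 3, the class RCA↑_α of representable directed cylindric algebras of dimension α is a finitely axiomatizable variety: there is a finite set E of equations in the signature (∩, −, C_i^↑, C_i^↓, D_{ij})_{i,j<α} such that an algebra of this signature belongs to RCA↑_α if and only if it satisfies every equation in E. -/
/-- An algebra of the signature `(∩, −, C_i^↑, C_i^↓, D_{ij})_{i,j<α}` of directed
cylindric algebras of dimension `I`. -/
structure DCAOps (I : Type u) (A : Type v) where
  inf : A → A → A
  compl : A → A
  cUp : I → A → A
  cDown : I → A → A
  d : I → I → A

/-- `(U, R)` is a weak P-structure. -/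
def IsWeakPStructure {U : Type*} (R : U → U → Prop) : Prop :=
  ∀ a b : U, ∃ c : U, R a c ∧ R b c

/-- `(U, R)` is a P-structure. -/
def IsPStructure {U : Type*} (R : U → U → Prop) : Prop :=
  ∀ a b : U, ∃ c : U, ∀ d : U, R d c ↔ (d = a ∨ d = b)

/-- `(U, R)` is extensional. -/
def IsExtensional {U : Type*} (R : U → U → Prop) : Prop :=
  ∀ a b : U, (∀ c : U, R c a ↔ R c b) → a = b

/-- Concrete upward directed cylindrification `C_i^{↑(R)}`. -/
def cylUpSet {I U : Type*} (R : U → U → Prop) (i : I) (X : Set (I → U)) :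
    Set (I → U) :=
  {s | ∃ z ∈ X, R (z i) (s i) ∧ ∀ j, j ≠ i → s j = z j}

/-- Concrete downward directed cylindrification `C_i^{↓(R)}`. -/
def cylDownSet {I U : Type*} (R : U → U → Prop) (i : I) (X : Set (I → U)) :
    Set (I → U) :=
  {s | ∃ z ∈ X, R (s i) (z i) ∧ ∀ j, j ≠ i → s j = z j}

/-- Concrete diagonal element. -/
def diagSet {I U : Type*} (i j : I) : Set (I → U) := {s | s i = s j}

/-- `Q ∈ RCA↑_I = SP Cs↑_I` : `Q` is isomorphic to a subalgebra of a direct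
product of full w-directed cylindric set algebras whose base structures are
extensional P-structures. -/
def IsRepresentableDCA {I A : Type} (Q : DCAOps I A) : Prop :=
  ∃ (K : Type) (U : K → Type) (R : ∀ k, U k → U k → Prop),
    (∀ k, IsWeakPStructure (R k) ∧ IsPStructure (R k) ∧ IsExtensional (R k)) ∧
    ∃ h : A → ∀ k, Set (I → U k),
      Function.Injective h ∧
      (∀ x y k, h (Q.inf x y) k = h x k ∩ h y k) ∧
      (∀ x k, h (Q.compl x) k = (h x k)ᶜ) ∧
      (∀ i x k, h (Q.cUp i x) k = cylUpSet (R k) i (h x k)) ∧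
      (∀ i x k, h (Q.cDown i x) k = cylDownSet (R k) i (h x k)) ∧
      (∀ i j k, h (Q.d i j) k = diagSet i j)

/-- Terms of the directed cylindric signature over countably many variables. -/
inductive DTerm (I : Type u) : Type u where
  | var : ℕ → DTerm I
  | inf : DTerm I → DTerm I → DTerm I
  | compl : DTerm I → DTerm I
  | cUp : I → DTerm I → DTerm I
  | cDown : I → DTerm I → DTerm I
  | diag : I → I → DTerm I

/-- Evaluation of a term in an algebra of the directed cylindric signature under
an assignment of the variables. -/
def DTerm.realize {I A : Type} (Q : DCAOps I A) (v : ℕ → A) : DTerm I → A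
  | var n => v n
  | inf t₁ t₂ => Q.inf (t₁.realize Q v) (t₂.realize Q v)
  | compl t => Q.compl (t.realize Q v)
  | cUp i t => Q.cUp i (t.realize Q v)
  | cDown i t => Q.cDown i (t.realize Q v)
  | diag i j => Q.d i j

namespace DCAOps

/-- Homomorphisms of algebras of the directed cylindric signature. -/
structure IsHom {I A B : Type} (φ : A → B) (Q : DCAOps I A) (Q' : DCAOps I B) : Prop where
  inf : ∀ x y, φ (Q.inf x y) = Q'.inf (φ x) (φ y)
  compl : ∀ x, φ (Q.compl x) = Q'.compl (φ x)
  cUp : ∀ i x, φ (Q.cUp i x) = Q'.cUp i (φ x)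
  cDown : ∀ i x, φ (Q.cDown i x) = Q'.cDown i (φ x)
  d : ∀ i j, φ (Q.d i j) = Q'.d i j

/-- The absolutely free algebra of terms. -/
def termOps (I : Type) : DCAOps I (DTerm I) :=
  ⟨DTerm.inf, DTerm.compl, DTerm.cUp, DTerm.cDown, DTerm.diag⟩

/-- The full w-directed cylindric set algebra with base `(U, R)`. -/
def full (I : Type) {U : Type} (R : U → U → Prop) : DCAOps I (Set (I → U)) :=
  ⟨fun X Y => X ∩ Y, fun X => Xᶜ, cylUpSet R, cylDownSet R, diagSet⟩

section Derived

variable {I A B : Type} (Q : DCAOps I A)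

/-- Join. -/
def sup (x y : A) : A := Q.compl (Q.inf (Q.compl x) (Q.compl y))

/-- The undirected cylindrification. -/
def cyl (i : I) (x : A) : A := Q.cDown i (Q.cUp i x)

variable [Nontrivial I]

/-- The top element, as a constant term. -/
noncomputable def top : A := Q.d (Classical.arbitrary I) (Classical.arbitrary I)

/-- An index different from `i`. -/
noncomputable def other (i : I) : I := (exists_ne i).choose

lemma other_ne (i : I) : other i ≠ i := (exists_ne i).choose_spec

/-- For a modality `m` with accessibility relation `ρ`, the set of points whose `i`-th coordinate
has exactly one `ρ`-successor. -/
noncomputable def uniq (m : I → A → A) (i : I) : A :=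
  Q.cyl (other i) (Q.inf (m i (Q.d i (other i))) (Q.compl (m i (Q.compl (Q.d i (other i))))))

/-- The substitution along the function that maps a point to its unique `ρ`-successor if there
is one, and to itself otherwise. -/
noncomputable def subst (m : I → A → A) (i : I) (x : A) : A :=
  Q.sup (Q.inf (Q.uniq m i) (m i x)) (Q.inf (Q.compl (Q.uniq m i)) x)

/-- The modality of the first projection: going to a member of a singleton member. -/
noncomputable def pathFst (i : I) (x : A) : A :=
  Q.cUp i (Q.inf (Q.uniq Q.cUp i) (Q.cUp i x))

/-- The modality of the second projection: going to a member of a singleton member of a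
non-singleton member. -/
noncomputable def pathSnd (i : I) (x : A) : A :=
  Q.cUp i (Q.inf (Q.compl (Q.uniq Q.cUp i)) (Q.pathFst i x))

/-- Substitution along the first (`true`) or second (`false`) projection. -/
noncomputable def prj (b : Bool) (i : I) (x : A) : A :=
  Q.subst (cond b Q.pathFst Q.pathSnd) i x

/-- The directed cylindrifications and the projections. -/
noncomputable def stp : Bool ⊕ Bool → I → A → A
  | .inl b => cond b Q.cUp Q.cDown
  | .inr b => Q.prj b

/-- Substitution along a composite of projections, the leftmost one being applied first. -/
noncomputable def word (t : List Bool) (i : I) (x : A) : A :=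
  t.foldr (fun b y => Q.prj b i y) x

variable [Fintype I]

/-- Simultaneous substitution of the terms `τ i`. -/
noncomputable def op (τ : I → List Bool) (x : A) : A :=
  Finset.univ.toList.foldr (fun i y => Q.word (τ i) i y) x

/-- Cylindrification over all coordinates. -/
noncomputable def cylAll (x : A) : A := Finset.univ.toList.foldr Q.cyl x

/-- The set of constant sequences. -/
noncomputable def diagAll : A :=
  Finset.univ.toList.foldr (fun i y => Q.inf (Q.d (Classical.arbitrary I) i) y) Q.top

end Derived

/-- A term picking the `n`-th entry of a coded sequence. -/
def entry (n : ℕ) : List Bool := List.replicate n false ++ [true]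

/-- The terms picking the entries of a coded `I`-sequence. -/
noncomputable def entries {I : Type} [Fintype I] (i : I) : List Bool :=
  entry (Fintype.equivFin I i)

section Map

variable {I A B : Type} {Q : DCAOps I A} {Q' : DCAOps I B} {φ : A → B} (h : IsHom φ Q Q')
include h

lemma IsHom.sup (x y : A) : φ (Q.sup x y) = Q'.sup (φ x) (φ y) := by
  simp only [DCAOps.sup, h.inf, h.compl]

lemma IsHom.cyl (i : I) (x : A) : φ (Q.cyl i x) = Q'.cyl i (φ x) := by
  simp only [DCAOps.cyl, h.cUp, h.cDown]

variable [Nontrivial I]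

lemma IsHom.top : φ Q.top = Q'.top := h.d _ _

lemma IsHom.uniq {m : I → A → A} {m' : I → B → B} (hm : ∀ i x, φ (m i x) = m' i (φ x)) (i : I) :
    φ (Q.uniq m i) = Q'.uniq m' i := by
  simp only [DCAOps.uniq, h.cyl, h.inf, h.compl, h.d, hm]

lemma IsHom.pathFst (i : I) (x : A) : φ (Q.pathFst i x) = Q'.pathFst i (φ x) := by
  simp only [DCAOps.pathFst, h.cUp, h.inf, h.uniq h.cUp]

lemma IsHom.pathSnd (i : I) (x : A) : φ (Q.pathSnd i x) = Q'.pathSnd i (φ x) := by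
  simp only [DCAOps.pathSnd, h.cUp, h.inf, h.compl, h.uniq h.cUp, h.pathFst]

lemma IsHom.prj (b : Bool) (i : I) (x : A) : φ (Q.prj b i x) = Q'.prj b i (φ x) := by
  have hm : ∀ i x, φ ((cond b Q.pathFst Q.pathSnd) i x) =
      (cond b Q'.pathFst Q'.pathSnd) i (φ x) := by
    cases b
    · exact h.pathSnd
    · exact h.pathFst
  simp only [DCAOps.prj, DCAOps.subst, h.sup, h.inf, h.compl, h.uniq hm, hm]

lemma IsHom.stp (s : Bool ⊕ Bool) (i : I) (x : A) : φ (Q.stp s i x) = Q'.stp s i (φ x) := by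
  rcases s with (_ | _) | b
  · exact h.cDown i x
  · exact h.cUp i x
  · exact h.prj b i x

lemma IsHom.word (t : List Bool) (i : I) (x : A) : φ (Q.word t i x) = Q'.word t i (φ x) := by
  induction t with
  | nil => rfl
  | cons b t ih => exact (h.prj _ _ _).trans (congrArg _ ih)

variable [Fintype I]

lemma IsHom.op (τ : I → List Bool) (x : A) : φ (Q.op τ x) = Q'.op τ (φ x) := by
  unfold DCAOps.op
  induction (Finset.univ : Finset I).toList with
  | nil => rfl
  | cons i L ih => exact (h.word _ _ _).trans (congrArg _ ih)

omit [Nontrivial I] in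
lemma IsHom.cylAll (x : A) : φ (Q.cylAll x) = Q'.cylAll (φ x) := by
  unfold DCAOps.cylAll
  induction (Finset.univ : Finset I).toList with
  | nil => rfl
  | cons i L ih => exact (h.cyl _ _).trans (congrArg _ ih)

lemma IsHom.diagAll : φ Q.diagAll = Q'.diagAll := by
  unfold DCAOps.diagAll
  induction (Finset.univ : Finset I).toList with
  | nil => exact h.top
  | cons i L ih => simp only [List.foldr_cons, h.inf, h.d, ih]

end Map

section Equations

variable {I A : Type} [Nontrivial I] [Fintype I] [DecidableEq I] (Q : DCAOps I A)

/-- The equation expressing `x ≤ y`. -/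
def leq (x y : A) : A × A := (Q.inf x y, x)

/-- The axioms without distinctness conditions on the indices. -/
noncomputable def laws₁ (x y z : A) (i j k : I) (b : Bool) : List (A × A) :=
  [(Q.inf x y, Q.inf y x),
   (Q.inf (Q.inf x y) z, Q.inf x (Q.inf y z)),
   (Q.inf x x, x),
   (Q.compl (Q.compl x), x),
   (Q.inf x Q.top, x),
   (Q.inf x (Q.compl x), Q.compl Q.top),
   (Q.inf (Q.compl x) (Q.compl (Q.inf x y)), Q.compl x),
   Q.leq (Q.inf (Q.sup x y) (Q.sup x z)) (Q.sup x (Q.inf y z)),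
   (Q.d i i, Q.top),
   (Q.d i j, Q.d j i),
   Q.leq (Q.inf (Q.d k i) (Q.d k j)) (Q.d i j),
   Q.leq x (Q.cyl i x),
   (Q.prj b i (Q.cyl i x), Q.cyl i x),
   (Q.prj b i (Q.inf x y), Q.inf (Q.prj b i x) (Q.prj b i y)),
   (Q.prj b i (Q.compl x), Q.compl (Q.prj b i x)),
   Q.leq (Q.inf (Q.inf x Q.diagAll) (Q.cyl i y)) (Q.cylAll (Q.inf Q.diagAll
    (Q.inf (Q.op (fun _ => [false]) x) (Q.op (Function.update (fun _ => [false]) i [true]) y)))),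
   (Q.cylAll (Q.compl Q.top), Q.compl Q.top),
   Q.leq x (Q.cylAll (Q.inf Q.diagAll (Q.op entries x)))]

/-- The axioms for two distinct indices. -/
noncomputable def laws₂ (x y : A) (i j : I) (b : Bool) (s : Bool ⊕ Bool) : List (A × A) :=
  [(Q.prj b i (Q.stp s j x), Q.stp s j (Q.prj b i x)),
   Q.leq (Q.d i j) (Q.prj b i (Q.prj b j (Q.d i j))),
   (Q.inf (Q.d i j) x, Q.inf (Q.d i j) (Q.cyl i (Q.inf (Q.d i j) x))),
   (Q.cDown j (Q.d i j), Q.cUp i (Q.d j i)),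
   (Q.cyl i (Q.inf (Q.cyl j x) (Q.stp s i y)), Q.cyl i (Q.inf (Q.cyl j (Q.inf
    (Q.cyl i (Q.inf (Q.d i j) (Q.cyl j x))) (Q.stp s j (Q.d i j)))) y))]

/-- The axioms for three distinct indices; the last two express that the base is an extensional
P-structure. -/
noncomputable def laws₃ (i j k : I) (s : Bool ⊕ Bool) : List (A × A) :=
  [(Q.cyl k (Q.d i j), Q.d i j),
   (Q.cyl k (Q.inf (Q.d k i) (Q.d k j)), Q.d i j),
   (Q.cyl k (Q.inf (Q.d k i) (Q.stp s k (Q.d j k))), Q.stp s i (Q.d j i)),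
   Q.leq (Q.inf (Q.d i k) (Q.cUp j (Q.d i j))) (Q.cUp j (Q.d k j)),
   Q.leq (Q.inf (Q.d j k) (Q.cUp j (Q.d i j))) (Q.cUp k (Q.d i k)),
   (Q.cyl k (Q.inf (Q.inf (Q.cUp k (Q.d i k)) (Q.cUp k (Q.d j k)))
    (Q.compl (Q.cUp k (Q.inf (Q.compl (Q.d i k)) (Q.compl (Q.d j k)))))), Q.top),
   Q.leq (Q.inf
    (Q.compl (Q.cyl k (Q.inf (Q.cUp i (Q.d k i)) (Q.compl (Q.cUp j (Q.d k j))))))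
    (Q.compl (Q.cyl k (Q.inf (Q.compl (Q.cUp i (Q.d k i))) (Q.cUp j (Q.d k j)))))) (Q.d i j)]

/-- The instances of the axioms for the given elements. -/
def lawSet (x y z : A) : Set (A × A) :=
  {p | ∃ (i j k : I) (b : Bool) (s : Bool ⊕ Bool), p ∈ Q.laws₁ x y z i j k b ∨
    (i ≠ j ∧ p ∈ Q.laws₂ x y i j b s) ∨
    (i ≠ j ∧ i ≠ k ∧ j ≠ k ∧ p ∈ Q.laws₃ i j k s)}

/-- The finite set of equations axiomatizing the representable algebras. -/
def equations (I : Type) [Nontrivial I] [Fintype I] [DecidableEq I] : Set (DTerm I × DTerm I) :=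
  (termOps I).lawSet (.var 0) (.var 1) (.var 2)

/-- All instances of the axioms hold. -/
def Laws : Prop := ∀ x y z : A, ∀ p ∈ Q.lawSet x y z, p.1 = p.2

lemma finite_equations : (equations I).Finite := by
  have : equations I = ⋃ (i : I) (j : I) (k : I) (b : Bool) (s : Bool ⊕ Bool),
      {p | p ∈ (termOps I).laws₁ (.var 0) (.var 1) (.var 2) i j k b} ∪
      ({p | i ≠ j ∧ p ∈ (termOps I).laws₂ (.var 0) (.var 1) i j b s} ∪
      {p | i ≠ j ∧ i ≠ k ∧ j ≠ k ∧ p ∈ (termOps I).laws₃ i j k s}) := by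
    ext p
    simp only [equations, lawSet, Set.mem_ofPred_eq, Set.mem_iUnion, Set.mem_union]
  rw [this]
  refine Set.finite_iUnion fun i => Set.finite_iUnion fun j => Set.finite_iUnion fun k =>
    Set.finite_iUnion fun b => Set.finite_iUnion fun s => ?_
  refine (List.finite_toSet _).union (.union ?_ ?_)
  · exact (List.finite_toSet _).subset fun p hp => hp.2
  · exact (List.finite_toSet _).subset fun p hp => hp.2.2.2

variable {Q} in
lemma IsHom.lawSet {B : Type} {Q' : DCAOps I B} {φ : A → B} (h : IsHom φ Q Q') (x y z : A) :
    Q'.lawSet (φ x) (φ y) (φ z) = Prod.map φ φ '' Q.lawSet x y z := by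
  have h₁ : ∀ i j k b, Q'.laws₁ (φ x) (φ y) (φ z) i j k b =
      (Q.laws₁ x y z i j k b).map (Prod.map φ φ) := by
    intros
    simp only [laws₁, leq, List.map_cons, List.map_nil, Prod.map_apply, h.inf, h.compl, h.sup,
      h.cyl, h.top, h.prj, h.op, h.d, h.diagAll, h.cylAll]
  have h₂ : ∀ i j b s, Q'.laws₂ (φ x) (φ y) i j b s =
      (Q.laws₂ x y i j b s).map (Prod.map φ φ) := by
    intros
    simp only [laws₂, leq, List.map_cons, List.map_nil, Prod.map_apply, h.inf,
      h.cyl, h.prj, h.stp, h.d, h.cUp, h.cDown]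
  have h₃ : ∀ i j k s, Q'.laws₃ i j k s = (Q.laws₃ i j k s).map (Prod.map φ φ) := by
    intros
    simp only [laws₃, leq, List.map_cons, List.map_nil, Prod.map_apply, h.inf, h.compl,
      h.cyl, h.top, h.stp, h.d, h.cUp]
  ext p
  simp only [DCAOps.lawSet, h₁, h₂, h₃, List.mem_map, Set.mem_image, Set.mem_ofPred_eq]
  constructor
  · rintro ⟨i, j, k, b, s, ⟨q, hq, rfl⟩ | ⟨hij, q, hq, rfl⟩ | ⟨hij, hik, hjk, q, hq, rfl⟩⟩
    · exact ⟨q, ⟨i, j, k, b, s, .inl hq⟩, rfl⟩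
    · exact ⟨q, ⟨i, j, k, b, s, .inr (.inl ⟨hij, hq⟩)⟩, rfl⟩
    · exact ⟨q, ⟨i, j, k, b, s, .inr (.inr ⟨hij, hik, hjk, hq⟩)⟩, rfl⟩
  · rintro ⟨q, ⟨i, j, k, b, s, hq | ⟨hij, hq⟩ | ⟨hij, hik, hjk, hq⟩⟩, rfl⟩
    · exact ⟨i, j, k, b, s, .inl ⟨q, hq, rfl⟩⟩
    · exact ⟨i, j, k, b, s, .inr (.inl ⟨hij, q, hq, rfl⟩)⟩
    · exact ⟨i, j, k, b, s, .inr (.inr ⟨hij, hik, hjk, q, hq, rfl⟩)⟩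

omit [Nontrivial I] [Fintype I] [DecidableEq I] in
lemma isHom_realize (v : ℕ → A) : IsHom (DTerm.realize Q v) (termOps I) Q :=
  ⟨fun _ _ => rfl, fun _ => rfl, fun _ _ => rfl, fun _ _ => rfl, fun _ _ => rfl⟩

lemma forall_equations_iff :
    (∀ p ∈ equations I, ∀ v : ℕ → A, DTerm.realize Q v p.1 = DTerm.realize Q v p.2) ↔
      Q.Laws := by
  constructor
  · intro h x y z p hp
    let v : ℕ → A := fun n => if n = 0 then x else if n = 1 then y else z
    have := (Q.isHom_realize v).lawSet (.var 0) (.var 1) (.var 2)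
    have hp' : p ∈ Q.lawSet (DTerm.realize Q v (.var 0)) (DTerm.realize Q v (.var 1))
        (DTerm.realize Q v (.var 2)) := hp
    rw [this] at hp'
    obtain ⟨q, hq, rfl⟩ := hp'
    exact h q hq v
  · intro h p hp v
    refine h (v 0) (v 1) (v 2) (DTerm.realize Q v p.1, DTerm.realize Q v p.2) ?_
    have := (Q.isHom_realize v).lawSet (.var 0) (.var 1) (.var 2)
    refine this.symm.subset ?_
    exact ⟨p, hp, rfl⟩

end Equations

section Semantics

open Function

variable {I U : Type} {R : U → U → Prop}

/-- The value of the partial function with graph `ρ`, or the argument itself where `ρ` does not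
define a value. -/
noncomputable def value (ρ : U → U → Prop) (x : U) : U :=
  open Classical in if h : ∃! z, ρ x z then h.choose else x

lemma value_eq {ρ : U → U → Prop} {x z : U} (h : ∀ y, ρ x y ↔ y = z) : value ρ x = z := by
  have hu : ∃! y, ρ x y := ⟨z, (h z).2 rfl, fun y hy => (h y).1 hy⟩
  rw [value, dif_pos hu]
  exact (h _).1 hu.choose_spec.1

/-- `x` has exactly one member. -/
def IsSing (R : U → U → Prop) (x : U) : Prop := ∃! z, R z x

/-- `z` is a member of a singleton member of `x`. -/
def fstRel (R : U → U → Prop) (x z : U) : Prop := ∃ y, R y x ∧ IsSing R y ∧ R z y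

/-- `z` is a member of a singleton member of a non-singleton member of `x`. -/
def sndRel (R : U → U → Prop) (x z : U) : Prop := ∃ y, R y x ∧ ¬ IsSing R y ∧ fstRel R y z

/-- The first and the second projection. -/
noncomputable def proj (R : U → U → Prop) (b : Bool) : U → U :=
  value (cond b (fstRel R) (sndRel R))

/-- Composites of projections, the leftmost one being applied first. -/
noncomputable def term (R : U → U → Prop) (t : List Bool) (x : U) : U :=
  t.foldl (fun y b => proj R b y) x

/-- The accessibility relations. -/
def acc (R : U → U → Prop) : Bool ⊕ Bool → U → U → Prop
  | .inl b => fun x z => cond b (R z x) (R x z)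
  | .inr b => fun x z => z = proj R b x

lemma exists_pairing (hR : IsPStructure R) (a b : U) :
    ∃ x, proj R true x = a ∧ proj R false x = b := by
  rcases subsingleton_or_nontrivial U with hU | hU
  · exact ⟨a, Subsingleton.elim _ _, Subsingleton.elim _ _⟩
  obtain ⟨c, hc⟩ := exists_ne a
  obtain ⟨v, hv⟩ := hR a c
  obtain ⟨sa, hsa⟩ := hR a a
  obtain ⟨sb, hsb⟩ := hR b b
  obtain ⟨y, hy⟩ := hR sb v
  obtain ⟨x, hx⟩ := hR sa y
  simp only [or_self] at hsa hsb
  have sing_a : IsSing R sa := ⟨a, (hsa a).2 rfl, fun z hz => (hsa z).1 hz⟩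
  have sing_b : IsSing R sb := ⟨b, (hsb b).2 rfl, fun z hz => (hsb z).1 hz⟩
  have not_v : ¬ IsSing R v := fun h =>
    hc (h.unique ((hv c).2 (.inr rfl)) ((hv a).2 (.inl rfl)))
  have not_y : ¬ IsSing R y := fun h => by
    have : sb = v := h.unique ((hy sb).2 (.inl rfl)) ((hy v).2 (.inr rfl))
    exact not_v (this ▸ sing_b)
  have fst_y : ∀ z, fstRel R y z ↔ z = b := fun z => by
    constructor
    · rintro ⟨w, hw, hs, hz⟩
      rcases (hy w).1 hw with rfl | rfl
      · exact (hsb z).1 hz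
      · exact (not_v hs).elim
    · rintro rfl
      exact ⟨sb, (hy sb).2 (.inl rfl), sing_b, (hsb z).2 rfl⟩
  refine ⟨x, value_eq fun z => ?_, value_eq fun z => ?_⟩
  · constructor
    · rintro ⟨w, hw, hs, hz⟩
      rcases (hx w).1 hw with rfl | rfl
      · exact (hsa z).1 hz
      · exact (not_y hs).elim
    · rintro rfl
      exact ⟨sa, (hx sa).2 (.inl rfl), sing_a, (hsa z).2 rfl⟩
  · constructor
    · rintro ⟨w, hw, hs, hz⟩
      rcases (hx w).1 hw with rfl | rfl
      · exact (hs sing_a).elim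
      · exact (fst_y z).1 hz
    · rintro rfl
      exact ⟨y, (hx y).2 (.inr rfl), not_y, (fst_y z).2 rfl⟩

lemma exists_entries (hR : IsPStructure R) (N : ℕ) (f : ℕ → U) (u : U) :
    ∃ w, ∀ n < N, term R (entry n) w = f n := by
  induction N generalizing f with
  | zero => exact ⟨u, fun n hn => absurd hn (Nat.not_lt_zero n)⟩
  | succ N ih =>
    obtain ⟨w, hw⟩ := ih fun n => f (n + 1)
    obtain ⟨x, hx₁, hx₂⟩ := exists_pairing hR (f 0) w
    refine ⟨x, fun n hn => ?_⟩
    cases n with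
    | zero => exact hx₁
    | succ n =>
      rw [← hw n (by omega), ← hx₂]
      rfl

lemma _root_.IsPStructure.isWeakPStructure (hR : IsPStructure R) : IsWeakPStructure R :=
  fun a b => (hR a b).imp fun _ hc => ⟨(hc a).2 (.inl rfl), (hc b).2 (.inr rfl)⟩

lemma mem_inf {X Y : Set (I → U)} {s : I → U} : s ∈ (full I R).inf X Y ↔ s ∈ X ∧ s ∈ Y := .rfl

lemma mem_compl {X : Set (I → U)} {s : I → U} : s ∈ (full I R).compl X ↔ s ∉ X := .rfl

lemma mem_d {i j : I} {s : I → U} : s ∈ (full I R).d i j ↔ s i = s j := .rfl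

lemma mem_sup {X Y : Set (I → U)} {s : I → U} : s ∈ (full I R).sup X Y ↔ s ∈ X ∨ s ∈ Y := by
  simp only [sup, mem_inf, mem_compl]
  tauto

lemma mem_top [Nontrivial I] {s : I → U} : s ∈ (full I R).top := (rfl : s _ = s _)

variable [DecidableEq I]

lemma mem_cUp {i : I} {X : Set (I → U)} {s : I → U} :
    s ∈ (full I R).cUp i X ↔ ∃ z, R z (s i) ∧ update s i z ∈ X := by
  constructor
  · rintro ⟨z, hz, hr, he⟩
    refine ⟨z i, hr, ?_⟩
    rwa [update_eq_iff.2 ⟨rfl, he⟩]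
  · rintro ⟨z, hr, hz⟩
    exact ⟨_, hz, by simpa using hr, fun j hj => (update_of_ne hj _ _).symm⟩

lemma mem_cDown {i : I} {X : Set (I → U)} {s : I → U} :
    s ∈ (full I R).cDown i X ↔ ∃ z, R (s i) z ∧ update s i z ∈ X := by
  constructor
  · rintro ⟨z, hz, hr, he⟩
    refine ⟨z i, hr, ?_⟩
    rwa [update_eq_iff.2 ⟨rfl, he⟩]
  · rintro ⟨z, hr, hz⟩
    exact ⟨_, hz, by simpa using hr, fun j hj => (update_of_ne hj _ _).symm⟩

variable (hR : IsPStructure R)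
include hR

lemma mem_cyl {i : I} {X : Set (I → U)} {s : I → U} :
    s ∈ (full I R).cyl i X ↔ ∃ z, update s i z ∈ X := by
  simp only [cyl, mem_cUp, mem_cDown, update_self, update_idem]
  constructor
  · rintro ⟨y, -, z, -, hz⟩
    exact ⟨z, hz⟩
  · rintro ⟨z, hz⟩
    obtain ⟨y, h₁, h₂⟩ := hR.isWeakPStructure (s i) z
    exact ⟨y, h₁, z, h₂, hz⟩

section

variable [Nontrivial I]

lemma mem_uniq {m : I → Set (I → U) → Set (I → U)} {ρ : U → U → Prop}
    (hm : ∀ i X s, s ∈ m i X ↔ ∃ z, ρ (s i) z ∧ update s i z ∈ X) {i : I} {s : I → U} :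
    s ∈ (full I R).uniq m i ↔ ∃! z, ρ (s i) z := by
  have hne := other_ne i
  simp only [uniq, mem_cyl hR, mem_inf, mem_compl, hm, mem_d, update_self, update_of_ne hne,
    update_of_ne hne.symm]
  refine exists_congr fun z => ?_
  constructor
  · rintro ⟨⟨y, hy, rfl⟩, h⟩
    exact ⟨hy, fun x hx => by_contra fun hxy => h ⟨x, hx, hxy⟩⟩
  · rintro ⟨h₁, h₂⟩
    exact ⟨⟨z, h₁, rfl⟩, fun ⟨x, hx, hxz⟩ => hxz (h₂ x hx)⟩

lemma mem_subst {m : I → Set (I → U) → Set (I → U)} {ρ : U → U → Prop}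
    (hm : ∀ i X s, s ∈ m i X ↔ ∃ z, ρ (s i) z ∧ update s i z ∈ X) {i : I} {X : Set (I → U)}
    {s : I → U} :
    s ∈ (full I R).subst m i X ↔ update s i (value ρ (s i)) ∈ X := by
  simp only [subst, mem_sup, mem_inf, mem_compl, mem_uniq hR hm, hm]
  by_cases h : ∃! z, ρ (s i) z
  · rw [value, dif_pos h]
    have hc := h.choose_spec
    generalize h.choose = c at hc
    simp only [h, true_and, not_true, false_and, or_false]
    constructor
    · rintro ⟨z, hz, hX⟩
      rwa [← hc.2 z hz]
    · exact fun hX => ⟨c, hc.1, hX⟩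
  · rw [value, dif_neg h, update_eq_self]
    simp only [h, false_and, false_or, not_false_eq_true, true_and]

lemma mem_pathFst {i : I} {X : Set (I → U)} {s : I → U} :
    s ∈ (full I R).pathFst i X ↔ ∃ z, fstRel R (s i) z ∧ update s i z ∈ X := by
  simp only [pathFst, mem_cUp, mem_inf,
    mem_uniq (ρ := fun x z => R z x) hR fun _ _ _ => mem_cUp, update_self, update_idem, fstRel,
    IsSing]
  constructor
  · rintro ⟨y, hy, hs, z, hz, hX⟩
    exact ⟨z, ⟨y, hy, hs, hz⟩, hX⟩
  · rintro ⟨z, ⟨y, hy, hs, hz⟩, hX⟩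
    exact ⟨y, hy, hs, z, hz, hX⟩

lemma mem_pathSnd {i : I} {X : Set (I → U)} {s : I → U} :
    s ∈ (full I R).pathSnd i X ↔ ∃ z, sndRel R (s i) z ∧ update s i z ∈ X := by
  simp only [pathSnd, mem_cUp, mem_inf, mem_compl, mem_pathFst hR,
    mem_uniq (ρ := fun x z => R z x) hR fun _ _ _ => mem_cUp, update_self, update_idem, sndRel,
    IsSing]
  constructor
  · rintro ⟨y, hy, hs, z, hz, hX⟩
    exact ⟨z, ⟨y, hy, hs, hz⟩, hX⟩
  · rintro ⟨z, ⟨y, hy, hs, hz⟩, hX⟩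
    exact ⟨y, hy, hs, z, hz, hX⟩

lemma mem_prj {b : Bool} {i : I} {X : Set (I → U)} {s : I → U} :
    s ∈ (full I R).prj b i X ↔ update s i (proj R b (s i)) ∈ X := by
  cases b
  · exact mem_subst hR fun _ _ _ => mem_pathSnd hR
  · exact mem_subst hR fun _ _ _ => mem_pathFst hR

lemma mem_stp {a : Bool ⊕ Bool} {i : I} {X : Set (I → U)} {s : I → U} :
    s ∈ (full I R).stp a i X ↔ ∃ z, acc R a (s i) z ∧ update s i z ∈ X := by
  rcases a with (_ | _) | b
  · exact mem_cDown
  · exact mem_cUp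
  · simp only [stp, mem_prj hR, acc, exists_eq_left]

lemma mem_word {t : List Bool} {i : I} {X : Set (I → U)} {s : I → U} :
    s ∈ (full I R).word t i X ↔ update s i (term R t (s i)) ∈ X := by
  induction t generalizing s with
  | nil => simp [word, term]
  | cons b t ih =>
    refine (mem_prj hR).trans (ih.trans ?_)
    rw [update_self, update_idem]
    rfl

variable [Fintype I]

lemma mem_op {τ : I → List Bool} {X : Set (I → U)} {s : I → U} :
    s ∈ (full I R).op τ X ↔ (fun i => term R (τ i) (s i)) ∈ X := by
  have key : ∀ L : List I, L.Nodup → ∀ s : I → U,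
      s ∈ L.foldr (fun i y => (full I R).word (τ i) i y) X ↔
        (fun i => if i ∈ L then term R (τ i) (s i) else s i) ∈ X := by
    intro L
    induction L with
    | nil => intro _ s; simp
    | cons i L ih =>
      intro hL s
      rw [List.nodup_cons] at hL
      rw [List.foldr_cons, mem_word hR, ih hL.2]
      refine iff_of_eq (congrArg (· ∈ X) (funext fun j => ?_))
      rcases eq_or_ne j i with rfl | hj
      · simp [hL.1]
      · simp [hj]
  exact (key _ (Finset.nodup_toList _) s).trans (by simp)

omit [Nontrivial I] in
lemma mem_cylAll {X : Set (I → U)} {s : I → U} : s ∈ (full I R).cylAll X ↔ X.Nonempty := by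
  have key : ∀ L : List I, ∀ s : I → U,
      s ∈ L.foldr (full I R).cyl X ↔ ∃ z ∈ X, ∀ i ∉ L, z i = s i := by
    intro L
    induction L with
    | nil =>
      intro s
      constructor
      · exact fun h => ⟨s, h, fun _ _ => rfl⟩
      · rintro ⟨z, hz, h⟩
        rwa [← show z = s from funext fun i => h i List.not_mem_nil]
    | cons i L ih =>
      intro s
      rw [List.foldr_cons, mem_cyl hR]
      simp only [ih, List.mem_cons, not_or]
      constructor
      · rintro ⟨u, z, hz, h⟩
        exact ⟨z, hz, fun j hj => (h j hj.2).trans (update_of_ne hj.1 _ _)⟩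
      · rintro ⟨z, hz, h⟩
        refine ⟨z i, z, hz, fun j hj => ?_⟩
        rcases eq_or_ne j i with rfl | hji
        · rw [update_self]
        · rw [update_of_ne hji, h j ⟨hji, hj⟩]
  exact (key _ s).trans (by simp [Set.Nonempty])

omit [DecidableEq I] hR in
lemma mem_diagAll {s : I → U} : s ∈ (full I R).diagAll ↔ ∀ i j, s i = s j := by
  have key : ∀ L : List I,
      s ∈ L.foldr (fun i y => (full I R).inf ((full I R).d (Classical.arbitrary I) i) y)
        (full I R).top ↔ ∀ i ∈ L, s (Classical.arbitrary I) = s i := by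
    intro L
    induction L with
    | nil => simpa using mem_top
    | cons i L ih => rw [List.foldr_cons, mem_inf, ih, List.forall_mem_cons, mem_d]
  refine (key _).trans ?_
  simp only [Finset.mem_toList, Finset.mem_univ, true_imp_iff]
  exact ⟨fun h i j => (h i).symm.trans (h j), fun h i => h _ i⟩

lemma full_laws (hE : IsExtensional R) : (full I R).Laws := by
  have le_iff : ∀ X Y : Set (I → U), (full I R).inf X Y = X ↔ ∀ s ∈ X, s ∈ Y :=
    fun X Y => Set.inter_eq_left
  rintro X Y Z p ⟨i, j, k, b, a, hp | ⟨hij, hp⟩ | ⟨hij, hik, hjk, hp⟩⟩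
  · revert p
    simp only [laws₁, leq, List.forall_mem_cons, List.not_mem_nil, false_imp_iff, implies_true,
      and_true, le_iff]
    simp only [Set.ext_iff, mem_inf, mem_compl, mem_sup, mem_top, mem_d, mem_cyl hR, mem_prj hR,
      mem_cylAll hR, mem_diagAll, not_true, update_idem]
    refine ⟨?_, ?_, ?_, ?_, ?_, ?_, ?_, ?_, ?_, ?_, ?_, ?_, ?_, ?_, ?_, ?_, ?_, ?_⟩
    iterate 10 (intros; tauto)
    · exact fun s hs => hs.1.symm.trans hs.2
    · exact fun s hs => ⟨s i, by rwa [update_eq_self]⟩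
    iterate 3 exact fun _ => trivial
    · rintro s ⟨⟨hs, hd⟩, z, hz⟩
      obtain ⟨w, hw₁, hw₂⟩ := exists_pairing hR z (s i)
      refine ⟨fun _ => w, mem_diagAll.2 fun _ _ => rfl, (mem_op hR).2 ?_, (mem_op hR).2 ?_⟩
      · convert hs with l
        exact hw₂.trans (hd _ _)
      · convert hz with l
        rcases eq_or_ne l i with rfl | hl
        · rw [update_self, update_self]
          exact hw₁
        · rw [update_of_ne hl, update_of_ne hl]
          exact hw₂.trans (hd _ _)
    · exact fun _ => iff_false_intro fun ⟨s, hs⟩ => hs mem_top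
    · intro s hs
      obtain ⟨w, hw⟩ := exists_entries hR (Fintype.card I)
        (fun n => if h : n < Fintype.card I then s ((Fintype.equivFin I).symm ⟨n, h⟩) else s i) (s i)
      refine ⟨fun _ => w, mem_diagAll.2 fun _ _ => rfl, (mem_op hR).2 ?_⟩
      convert hs with l
      refine (hw _ (Fintype.equivFin I l).2).trans ?_
      simp
  · revert p
    simp only [laws₂, leq, List.forall_mem_cons, List.not_mem_nil, false_imp_iff, implies_true,
      and_true, le_iff]
    simp only [Set.ext_iff, mem_inf, mem_d, mem_cyl hR, mem_prj hR,
      mem_stp hR, mem_cUp, mem_cDown, update_self, update_idem, update_of_ne hij,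
      update_of_ne hij.symm]
    refine ⟨?_, ?_, ?_, ?_, ?_⟩
    · intro s
      simp only [update_comm hij]
    · intro s hs
      rw [hs]
    · intro s
      refine and_congr_right fun hs => ?_
      rw [exists_eq_left, ← hs, update_eq_self]
    · simp
    · intro s
      simp only [exists_eq_left, update_comm hij, update_idem]
      constructor
      · rintro ⟨z, h, w, hw, hY⟩
        exact ⟨w, ⟨z, h, w, hw, rfl⟩, hY⟩
      · rintro ⟨w, ⟨z, h, _, hw, rfl⟩, hY⟩
        exact ⟨z, h, w, hw, hY⟩
  · revert p
    simp only [laws₃, leq, List.forall_mem_cons, List.not_mem_nil, false_imp_iff, implies_true,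
      and_true, le_iff]
    simp only [Set.ext_iff, mem_inf, mem_compl, mem_top, mem_d, mem_cyl hR,
      mem_stp hR, mem_cUp, update_self, update_of_ne hij,
      update_of_ne hij.symm, update_of_ne hik, update_of_ne hik.symm, update_of_ne hjk,
      update_of_ne hjk.symm]
    refine ⟨?_, ?_, ?_, ?_, ?_, ?_, ?_⟩
    · exact fun s => ⟨fun ⟨_, hs⟩ => hs, fun hs => ⟨s i, hs⟩⟩
    · simp
    · simp
    · grind
    · grind
    · intro s
      obtain ⟨c, hc⟩ := hR (s i) (s j)
      refine iff_true_intro ⟨c, ⟨⟨_, (hc _).2 (.inl rfl), rfl⟩, _, (hc _).2 (.inr rfl), rfl⟩, ?_⟩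
      rintro ⟨z, hz, h₁, h₂⟩
      rcases (hc z).1 hz with rfl | rfl
      · exact h₁ rfl
      · exact h₂ rfl
    · rintro s ⟨h₁, h₂⟩
      refine hE _ _ fun c => ⟨fun hc => ?_, fun hc => ?_⟩
      · by_contra h
        exact h₁ ⟨c, ⟨c, hc, rfl⟩, fun ⟨_, hw, e⟩ => h (e ▸ hw)⟩
      · by_contra h
        exact h₂ ⟨c, fun ⟨_, hw, e⟩ => h (e ▸ hw), c, hc, rfl⟩

end

end Semantics

section Completeness

open Function

variable {I A : Type} [Nontrivial I] [Fintype I] [DecidableEq I] {Q : DCAOps I A}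

/-- The order of the algebra. -/
def Le (Q : DCAOps I A) (x y : A) : Prop := Q.inf x y = x

section NamedLaws

variable (h : Q.Laws)
include h

lemma Laws.get₁ (x y z : A) (i j k : I) (b : Bool) (n : ℕ) (hn : n < 18) :
    ((Q.laws₁ x y z i j k b)[n]'hn).1 = ((Q.laws₁ x y z i j k b)[n]'hn).2 :=
  h x y z _ ⟨i, j, k, b, .inl b, .inl (List.getElem_mem _)⟩

lemma Laws.get₂ (x y : A) {i j : I} (hij : i ≠ j) (b : Bool) (s : Bool ⊕ Bool) (n : ℕ)
    (hn : n < 5) :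
    ((Q.laws₂ x y i j b s)[n]'hn).1 = ((Q.laws₂ x y i j b s)[n]'hn).2 :=
  h x y x _ ⟨i, j, i, b, s, .inr (.inl ⟨hij, List.getElem_mem _⟩)⟩

lemma Laws.get₃ {i j k : I} (hij : i ≠ j) (hik : i ≠ k) (hjk : j ≠ k) (s : Bool ⊕ Bool) (n : ℕ)
    (hn : n < 7) :
    ((Q.laws₃ i j k s)[n]'hn).1 = ((Q.laws₃ i j k s)[n]'hn).2 :=
  h Q.top Q.top Q.top _ ⟨i, j, k, true, s, .inr (.inr ⟨hij, hik, hjk, List.getElem_mem _⟩)⟩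

lemma Laws.inf_comm (x y : A) : Q.inf x y = Q.inf y x :=
  h.get₁ x y y (Classical.arbitrary I) (Classical.arbitrary I) (Classical.arbitrary I) true 0
    (by decide)

lemma Laws.inf_assoc (x y z : A) : Q.inf (Q.inf x y) z = Q.inf x (Q.inf y z) :=
  h.get₁ x y z (Classical.arbitrary I) (Classical.arbitrary I) (Classical.arbitrary I) true 1
    (by decide)

lemma Laws.inf_self (x : A) : Q.inf x x = x :=
  h.get₁ x x x (Classical.arbitrary I) (Classical.arbitrary I) (Classical.arbitrary I) true 2
    (by decide)

lemma Laws.compl_compl (x : A) : Q.compl (Q.compl x) = x :=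
  h.get₁ x x x (Classical.arbitrary I) (Classical.arbitrary I) (Classical.arbitrary I) true 3
    (by decide)

lemma Laws.inf_top (x : A) : Q.inf x Q.top = x :=
  h.get₁ x x x (Classical.arbitrary I) (Classical.arbitrary I) (Classical.arbitrary I) true 4
    (by decide)

lemma Laws.inf_compl (x : A) : Q.inf x (Q.compl x) = Q.compl Q.top :=
  h.get₁ x x x (Classical.arbitrary I) (Classical.arbitrary I) (Classical.arbitrary I) true 5
    (by decide)

lemma Laws.compl_inf_compl_inf (x y : A) :
    Q.inf (Q.compl x) (Q.compl (Q.inf x y)) = Q.compl x :=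
  h.get₁ x y y (Classical.arbitrary I) (Classical.arbitrary I) (Classical.arbitrary I) true 6
    (by decide)

lemma Laws.le_sup_inf (x y z : A) :
    Q.Le (Q.inf (Q.sup x y) (Q.sup x z)) (Q.sup x (Q.inf y z)) :=
  h.get₁ x y z (Classical.arbitrary I) (Classical.arbitrary I) (Classical.arbitrary I) true 7
    (by decide)

lemma Laws.d_self (i : I) : Q.d i i = Q.top :=
  h.get₁ Q.top Q.top Q.top i i i true 8 (by decide)

lemma Laws.d_comm (i j : I) : Q.d i j = Q.d j i :=
  h.get₁ Q.top Q.top Q.top i j i true 9 (by decide)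

lemma Laws.d_trans (i j k : I) : Q.Le (Q.inf (Q.d k i) (Q.d k j)) (Q.d i j) :=
  h.get₁ Q.top Q.top Q.top i j k true 10 (by decide)

lemma Laws.le_cyl (i : I) (x : A) : Q.Le x (Q.cyl i x) :=
  h.get₁ x x x i i i true 11 (by decide)

lemma Laws.prj_cyl (b : Bool) (i : I) (x : A) : Q.prj b i (Q.cyl i x) = Q.cyl i x :=
  h.get₁ x x x i i i b 12 (by decide)

lemma Laws.prj_inf (b : Bool) (i : I) (x y : A) :
    Q.prj b i (Q.inf x y) = Q.inf (Q.prj b i x) (Q.prj b i y) :=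
  h.get₁ x y x i i i b 13 (by decide)

lemma Laws.prj_compl (b : Bool) (i : I) (x : A) :
    Q.prj b i (Q.compl x) = Q.compl (Q.prj b i x) :=
  h.get₁ x x x i i i b 14 (by decide)

lemma Laws.inf_diagAll_inf_cyl_le (i : I) (x y : A) :
    Q.Le (Q.inf (Q.inf x Q.diagAll) (Q.cyl i y)) (Q.cylAll (Q.inf Q.diagAll
      (Q.inf (Q.op (fun _ => [false]) x) (Q.op (update (fun _ => [false]) i [true]) y)))) :=
  h.get₁ x y x i i i true 15 (by decide)

lemma Laws.cylAll_compl_top : Q.cylAll (Q.compl Q.top) = Q.compl Q.top :=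
  h.get₁ Q.top Q.top Q.top (Classical.arbitrary I) (Classical.arbitrary I) (Classical.arbitrary I)
    true 16 (by decide)

lemma Laws.le_cylAll_entries (x : A) : Q.Le x (Q.cylAll (Q.inf Q.diagAll (Q.op entries x))) :=
  h.get₁ x x x (Classical.arbitrary I) (Classical.arbitrary I) (Classical.arbitrary I) true 17
    (by decide)

lemma Laws.prj_stp {i j : I} (hij : i ≠ j) (b : Bool) (s : Bool ⊕ Bool) (x : A) :
    Q.prj b i (Q.stp s j x) = Q.stp s j (Q.prj b i x) :=
  h.get₂ x x hij b s 0 (by decide)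

lemma Laws.d_le_prj_prj {i j : I} (hij : i ≠ j) (b : Bool) :
    Q.Le (Q.d i j) (Q.prj b i (Q.prj b j (Q.d i j))) :=
  h.get₂ Q.top Q.top hij b (.inl b) 1 (by decide)

lemma Laws.d_inf {i j : I} (hij : i ≠ j) (x : A) :
    Q.inf (Q.d i j) x = Q.inf (Q.d i j) (Q.cyl i (Q.inf (Q.d i j) x)) :=
  h.get₂ x x hij true (.inl true) 2 (by decide)

lemma Laws.cDown_d {i j : I} (hij : i ≠ j) : Q.cDown j (Q.d i j) = Q.cUp i (Q.d j i) :=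
  h.get₂ Q.top Q.top hij true (.inl true) 3 (by decide)

lemma Laws.cyl_inf_stp {i j : I} (hij : i ≠ j) (s : Bool ⊕ Bool) (x y : A) :
    Q.cyl i (Q.inf (Q.cyl j x) (Q.stp s i y)) = Q.cyl i (Q.inf (Q.cyl j (Q.inf
      (Q.cyl i (Q.inf (Q.d i j) (Q.cyl j x))) (Q.stp s j (Q.d i j)))) y) :=
  h.get₂ x y hij true s 4 (by decide)

variable {i j k : I} (hij : i ≠ j) (hik : i ≠ k) (hjk : j ≠ k)
include hij hik hjk

lemma Laws.cyl_d : Q.cyl k (Q.d i j) = Q.d i j :=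
  h.get₃ hij hik hjk (.inl true) 0 (by decide)

lemma Laws.cyl_d_inf_d : Q.cyl k (Q.inf (Q.d k i) (Q.d k j)) = Q.d i j :=
  h.get₃ hij hik hjk (.inl true) 1 (by decide)

lemma Laws.cyl_d_inf_stp (s : Bool ⊕ Bool) :
    Q.cyl k (Q.inf (Q.d k i) (Q.stp s k (Q.d j k))) = Q.stp s i (Q.d j i) :=
  h.get₃ hij hik hjk s 2 (by decide)

lemma Laws.d_inf_cUp_le_left : Q.Le (Q.inf (Q.d i k) (Q.cUp j (Q.d i j))) (Q.cUp j (Q.d k j)) :=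
  h.get₃ hij hik hjk (.inl true) 3 (by decide)

lemma Laws.d_inf_cUp_le_right : Q.Le (Q.inf (Q.d j k) (Q.cUp j (Q.d i j))) (Q.cUp k (Q.d i k)) :=
  h.get₃ hij hik hjk (.inl true) 4 (by decide)

lemma Laws.pairing : Q.cyl k (Q.inf (Q.inf (Q.cUp k (Q.d i k)) (Q.cUp k (Q.d j k)))
    (Q.compl (Q.cUp k (Q.inf (Q.compl (Q.d i k)) (Q.compl (Q.d j k)))))) = Q.top :=
  h.get₃ hij hik hjk (.inl true) 5 (by decide)

lemma Laws.extensionality : Q.Le (Q.inf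
    (Q.compl (Q.cyl k (Q.inf (Q.cUp i (Q.d k i)) (Q.compl (Q.cUp j (Q.d k j))))))
    (Q.compl (Q.cyl k (Q.inf (Q.compl (Q.cUp i (Q.d k i))) (Q.cUp j (Q.d k j)))))) (Q.d i j) :=
  h.get₃ hij hik hjk (.inl true) 6 (by decide)

omit hij hik hjk in
lemma Laws.le_trans {x y z : A} (hxy : Q.Le x y) (hyz : Q.Le y z) : Q.Le x z := by
  unfold Le at hxy hyz ⊢
  rw [← hxy, h.inf_assoc, hyz]

end NamedLaws

section Ultrafilters

/-- The Boolean reduct. -/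
noncomputable abbrev Laws.booleanAlgebra (h : Q.Laws) : BooleanAlgebra A :=
  let _ : Max A := ⟨Q.sup⟩
  let _ : Min A := ⟨Q.inf⟩
  let L : Lattice A := Lattice.mk'
    (fun x y => congrArg Q.compl (h.inf_comm _ _))
    (fun x y z => congrArg Q.compl (by
      change Q.inf (Q.compl (Q.sup x y)) (Q.compl z) = Q.inf (Q.compl x) (Q.compl (Q.sup y z))
      rw [sup, sup, h.compl_compl, h.compl_compl, h.inf_assoc]))
    h.inf_comm h.inf_assoc
    (fun x y => (congrArg Q.compl (h.compl_inf_compl_inf x y)).trans (h.compl_compl x))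
    (fun x y => by
      have := h.compl_inf_compl_inf (Q.compl x) (Q.compl y)
      rwa [h.compl_compl] at this)
  have le_iff : ∀ x y : A, x ≤ y ↔ Q.inf x y = x := fun _ _ => inf_eq_left.symm
  { L with
    le_sup_inf := fun x y z => (le_iff _ _).2 (h.le_sup_inf x y z)
    compl := Q.compl
    top := Q.top
    bot := Q.compl Q.top
    le_top := fun x => (le_iff _ _).2 (h.inf_top x)
    bot_le := fun x => (le_iff _ _).2 <| by
      rw [← h.inf_compl x, h.inf_comm x, h.inf_assoc, h.inf_self]
    inf_compl_le_bot := fun x => ((h.inf_compl x : x ⊓ Q.compl x = _)).le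
    top_le_sup_compl := fun x => by
      have : x ⊔ Q.compl x = Q.top := by
        change Q.compl (Q.inf (Q.compl x) (Q.compl (Q.compl x))) = _
        rw [h.inf_compl, h.compl_compl]
      exact this.ge }

/-- Ultrafilters. -/
structure IsUltra (Q : DCAOps I A) (F : A → Prop) : Prop where
  inf : ∀ x y, F (Q.inf x y) ↔ F x ∧ F y
  compl : ∀ x, F (Q.compl x) ↔ ¬ F x

omit [Nontrivial I] [Fintype I] [DecidableEq I] in
lemma IsUltra.mono {F : A → Prop} (hF : IsUltra Q F) {x y : A} (hxy : Q.Le x y) (hx : F x) :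
    F y := ((hF.inf x y).1 (by rwa [hxy])).2

lemma IsUltra.top {F : A → Prop} (hF : IsUltra Q F) (h : Q.Laws) : F Q.top := by
  by_cases hx : F (Q.top)
  · exact hx
  · exact hF.mono (h.inf_top _) ((hF.compl Q.top).2 hx)

lemma Laws.exists_isUltra (h : Q.Laws) (S : Set A) (hS : S.Nonempty)
    (hinf : ∀ x ∈ S, ∀ y ∈ S, Q.inf x y ∈ S) (hbot : Q.compl Q.top ∉ S) :
    ∃ F, IsUltra Q F ∧ ∀ x ∈ S, F x := by
  let _ := h.booleanAlgebra
  have hP : Order.IsPFilter {x : A | ∃ s ∈ S, s ≤ x} := by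
    refine Order.IsPFilter.of_def (hS.imp fun x hx => ⟨x, hx, le_rfl⟩) ?_ ?_
    · rintro x ⟨s, hs, hsx⟩ y ⟨t, ht, hty⟩
      exact ⟨s ⊓ t, ⟨_, hinf s hs t ht, le_rfl⟩, inf_le_left.trans hsx, inf_le_right.trans hty⟩
    · rintro x y hxy ⟨s, hs, hsx⟩
      exact ⟨s, hs, hsx.trans hxy⟩
  obtain ⟨J, hJ, -, hd⟩ := DistribLattice.prime_ideal_of_disjoint_filter_ideal
    (F := hP.toPFilter) (I := (⊥ : Order.Ideal A)) (by
      rw [Set.disjoint_left]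
      rintro x ⟨s, hs, hsx⟩ hx
      have : s = Q.compl Q.top := le_bot_iff.1 (hsx.trans hx)
      exact hbot (this ▸ hs))
  refine ⟨fun x => x ∉ J, ⟨fun x y => ?_, fun x => ?_⟩, fun x hx => ?_⟩
  · constructor
    · exact fun hxy => ⟨fun hx => hxy (J.lower inf_le_left hx),
        fun hy => hxy (J.lower inf_le_right hy)⟩
    · exact fun ⟨hx, hy⟩ hxy => (hJ.mem_or_mem hxy).elim hx hy
  · constructor
    · exact fun hc hx => (hJ.mem_or_compl_mem (x := x)).elim hx hc
    · intro hx hc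
      rw [not_not] at hx
      refine hJ.toIsProper.ne_univ (Set.eq_univ_of_forall fun y => J.lower le_top ?_)
      have := Order.Ideal.sup_mem hx hc
      rwa [show x ⊔ Q.compl x = ⊤ from sup_compl_eq_top] at this
  · exact Set.disjoint_left.1 hd ⟨x, hx, le_rfl⟩

lemma Laws.exists_isUltra_of_ne (h : Q.Laws) {a : A} (ha : a ≠ Q.compl Q.top) :
    ∃ F, IsUltra Q F ∧ F a := by
  obtain ⟨F, hF, hFa⟩ := h.exists_isUltra {a} ⟨a, rfl⟩
    (by rintro x rfl y rfl; exact h.inf_self _) ha.symm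
  exact ⟨F, hF, hFa a rfl⟩

end Ultrafilters

section Words

variable (h : Q.Laws)

omit [DecidableEq I] [Fintype I] in
lemma cyl_eq_stp (i : I) (x : A) :
    Q.cyl i x = Q.stp (.inl false) i (Q.stp (.inl true) i x) := rfl

omit [DecidableEq I] [Fintype I] in
lemma word_append (t t' : List Bool) (i : I) (x : A) :
    Q.word (t ++ t') i x = Q.word t i (Q.word t' i x) := List.foldr_append

include h

lemma Laws.word_inf (t : List Bool) (i : I) (x y : A) :
    Q.word t i (Q.inf x y) = Q.inf (Q.word t i x) (Q.word t i y) := by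
  induction t with
  | nil => rfl
  | cons b t ih => exact (congrArg _ ih).trans (h.prj_inf _ _ _ _)

lemma Laws.word_compl (t : List Bool) (i : I) (x : A) :
    Q.word t i (Q.compl x) = Q.compl (Q.word t i x) := by
  induction t with
  | nil => rfl
  | cons b t ih => exact (congrArg _ ih).trans (h.prj_compl _ _ _)

lemma Laws.word_mono (t : List Bool) (i : I) {x y : A} (hxy : Q.Le x y) :
    Q.Le (Q.word t i x) (Q.word t i y) := by
  rw [Le, ← h.word_inf, hxy]

lemma Laws.word_cyl (t : List Bool) (i : I) (x : A) : Q.word t i (Q.cyl i x) = Q.cyl i x := by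
  induction t with
  | nil => rfl
  | cons b t ih => exact (congrArg _ ih).trans (h.prj_cyl _ _ _)

lemma Laws.word_stp {i j : I} (hij : i ≠ j) (t : List Bool) (s : Bool ⊕ Bool) (x : A) :
    Q.word t i (Q.stp s j x) = Q.stp s j (Q.word t i x) := by
  induction t with
  | nil => rfl
  | cons b t ih => exact (congrArg _ ih).trans (h.prj_stp hij _ _ _)

lemma Laws.word_word {i j : I} (hij : i ≠ j) (t t' : List Bool) (x : A) :
    Q.word t i (Q.word t' j x) = Q.word t' j (Q.word t i x) := by
  induction t' with
  | nil => rfl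
  | cons b t' ih => exact (h.word_stp hij t (.inr b) _).trans (congrArg _ ih)

lemma Laws.word_cyl_of_ne {i j : I} (hij : i ≠ j) (t : List Bool) (x : A) :
    Q.word t i (Q.cyl j x) = Q.cyl j (Q.word t i x) := by
  simp only [cyl_eq_stp, h.word_stp hij]

lemma Laws.word_d {i j k : I} (hij : i ≠ j) (hik : i ≠ k) (hjk : j ≠ k) (t : List Bool) :
    Q.word t k (Q.d i j) = Q.d i j := by
  rw [← h.cyl_d hij hik hjk, h.word_cyl]

lemma Laws.d_le_word_word {i j : I} (hij : i ≠ j) (t : List Bool) :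
    Q.Le (Q.d i j) (Q.word t i (Q.word t j (Q.d i j))) := by
  induction t with
  | nil => exact h.inf_self _
  | cons b t ih =>
    have h₁ := h.d_le_prj_prj hij b
    have h₂ := h.word_mono [b] i (h.word_mono [b] j ih)
    have h₃ : Q.word [b] i (Q.word [b] j (Q.word t i (Q.word t j (Q.d i j)))) =
        Q.word (b :: t) i (Q.word (b :: t) j (Q.d i j)) := by
      rw [h.word_word hij.symm [b] t, ← word_append, ← word_append]
      rfl
    rw [h₃] at h₂
    change Q.Le _ (Q.word [b] i (Q.word [b] j (Q.d i j))) at h₁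
    exact h.le_trans h₁ h₂

variable (h3 : ∀ i j : I, ∃ k, i ≠ k ∧ j ≠ k)
include h3

lemma Laws.cyl_inf_word_stp {i j : I} (hij : i ≠ j) (t : List Bool) (s : Bool ⊕ Bool) (y : A) :
    Q.cyl i (Q.inf (Q.word t j (Q.d i j)) (Q.stp s i y)) =
      Q.cyl i (Q.inf (Q.word t j (Q.stp s j (Q.d i j))) y) := by
  obtain ⟨m, him, hjm⟩ := h3 i j
  have hV : Q.cyl m (Q.word t j (Q.d i j)) = Q.word t j (Q.d i j) := by
    rw [← h.word_cyl_of_ne hjm, h.cyl_d hij him hjm]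
  have hd : Q.word t j (Q.d i m) = Q.d i m := h.word_d him hij hjm.symm t
  have key := h.cyl_inf_stp him s (Q.word t j (Q.d i j)) y
  rw [hV] at key
  rw [key]
  nth_rw 1 [← hd]
  rw [← h.word_inf, ← h.word_cyl_of_ne hij.symm, h.cyl_d_inf_d hjm.symm him.symm hij.symm,
    ← hd, ← h.word_stp hjm, ← h.word_inf, ← h.word_cyl_of_ne hjm,
    h.cyl_d_inf_stp hij.symm hjm him]

/-- Replacing the `i`-th coordinate by a term of the `j`-th one, where the two agree. -/
lemma Laws.d_inf_word {i j : I} (hij : i ≠ j) (t : List Bool) (y : A) :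
    Q.inf (Q.d i j) (Q.word t i y) =
      Q.inf (Q.d i j) (Q.cyl i (Q.inf (Q.word t j (Q.d i j)) y)) := by
  induction t using List.reverseRecOn generalizing y with
  | nil => exact h.d_inf hij y
  | append_singleton t b ih =>
    rw [word_append, word_append, ih]
    exact congrArg _ (h.cyl_inf_word_stp h3 hij t (.inr b) y)

lemma Laws.d_inf_word_stp {i j : I} (hij : i ≠ j) (t : List Bool) (s : Bool ⊕ Bool) (y : A) :
    Q.inf (Q.d i j) (Q.word t i (Q.stp s i y)) =
      Q.inf (Q.d i j) (Q.cyl i (Q.inf (Q.word t j (Q.stp s j (Q.d i j))) y)) := by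
  rw [h.d_inf_word h3 hij, h.cyl_inf_word_stp h3 hij]

end Words

section Substitutions

variable (h : Q.Laws)

lemma foldr_comm {ι X : Type} {f : ι → X → X} {g : X → X} (L : List ι)
    (hg : ∀ i ∈ L, ∀ x, g (f i x) = f i (g x)) (x : X) : g (L.foldr f x) = L.foldr f (g x) := by
  induction L with
  | nil => rfl
  | cons i L ih =>
    rw [List.forall_mem_cons] at hg
    rw [List.foldr_cons, List.foldr_cons, hg.1, ih hg.2]

lemma foldr_foldr {ι X : Type} {f g : ι → X → X} {L : List ι} (hL : L.Nodup)
    (hfg : ∀ i j, i ≠ j → ∀ x, f i (g j x) = g j (f i x)) (x : X) :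
    L.foldr f (L.foldr g x) = L.foldr (fun i x => f i (g i x)) x := by
  induction L with
  | nil => rfl
  | cons i L ih =>
    rw [List.nodup_cons] at hL
    simp only [List.foldr_cons]
    rw [← foldr_comm L (fun j hj y => (hfg j i (ne_of_mem_of_not_mem hj hL.1) y).symm), ih hL.2]

lemma foldr_fix {ι X : Type} {f : ι → X → X} (L : List ι) {x : X} (hf : ∀ i ∈ L, f i x = x) :
    L.foldr f x = x := by
  induction L with
  | nil => rfl
  | cons i L ih =>
    rw [List.forall_mem_cons] at hf
    rw [List.foldr_cons, ih hf.2, hf.1]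

include h

lemma Laws.op_op (τ τ' : I → List Bool) (x : A) :
    Q.op τ (Q.op τ' x) = Q.op (fun i => τ i ++ τ' i) x := by
  refine (foldr_foldr (Finset.nodup_toList _) (fun i j hij => h.word_word hij _ _) x).trans ?_
  simp only [← word_append]
  rfl

lemma Laws.op_stp {τ : I → List Bool} {i : I} (hτ : τ i = []) (s : Bool ⊕ Bool) (x : A) :
    Q.op τ (Q.stp s i x) = Q.stp s i (Q.op τ x) := by
  refine (foldr_comm _ (fun j _ y => ?_) x).symm
  rcases eq_or_ne j i with rfl | hj
  · rw [hτ]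
    rfl
  · exact (h.word_stp hj _ _ _).symm

lemma Laws.op_congr {τ τ' : I → List Bool} {x : A}
    (hx : ∀ k, τ k = τ' k ∨ ∀ t, Q.word t k x = x) : Q.op τ x = Q.op τ' x := by
  unfold op
  have hL := Finset.nodup_toList (Finset.univ : Finset I)
  generalize (Finset.univ : Finset I).toList = L at hL
  induction L with
  | nil => rfl
  | cons k L ih =>
    rw [List.nodup_cons] at hL
    have hk : ∀ t, ∀ σ : I → List Bool, Q.word t k (L.foldr (fun i y => Q.word (σ i) i y) x) =
        L.foldr (fun i y => Q.word (σ i) i y) (Q.word t k x) := fun t σ =>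
      foldr_comm L (fun i hi y => h.word_word (ne_of_mem_of_not_mem hi hL.1).symm t (σ i) y) x
    rw [List.foldr_cons, List.foldr_cons]
    rcases hx k with e | e
    · rw [ih hL.2, e]
    · rw [hk, hk, e, e, ih hL.2]

omit h in
lemma op_single (i : I) (t : List Bool) (x : A) :
    Q.op (update (fun _ => []) i t) x = Q.word t i x := by
  unfold op
  have hL := Finset.nodup_toList (Finset.univ : Finset I)
  have hi : i ∈ (Finset.univ : Finset I).toList := by simp
  generalize (Finset.univ : Finset I).toList = L at hL hi
  induction L with
  | nil => cases hi
  | cons k L ih =>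
    rw [List.nodup_cons] at hL
    rw [List.foldr_cons]
    rcases eq_or_ne k i with rfl | hk
    · rw [update_self, foldr_fix]
      intro j hj
      rw [update_of_ne (ne_of_mem_of_not_mem hj hL.1)]
      rfl
    · rw [ih hL.2 ((List.mem_cons.1 hi).resolve_left hk.symm), update_of_ne hk]
      rfl

lemma Laws.op_update (τ : I → List Bool) (i : I) (t : List Bool) (x : A) :
    Q.op (update τ i t) x = Q.word t i (Q.op (update τ i []) x) := by
  rw [← op_single, h.op_op]
  congr 1
  funext k
  rcases eq_or_ne k i with rfl | hk
  · simp
  · simp [hk]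

lemma Laws.op_eq_word (τ : I → List Bool) (i : I) (x : A) :
    Q.op τ x = Q.word (τ i) i (Q.op (update τ i []) x) := by
  rw [← h.op_update, update_eq_self]

lemma Laws.op_inf (τ : I → List Bool) (x y : A) :
    Q.op τ (Q.inf x y) = Q.inf (Q.op τ x) (Q.op τ y) := by
  unfold op
  induction (Finset.univ : Finset I).toList with
  | nil => rfl
  | cons i L ih => rw [List.foldr_cons, ih, h.word_inf, List.foldr_cons, List.foldr_cons]

lemma Laws.op_compl (τ : I → List Bool) (x : A) :
    Q.op τ (Q.compl x) = Q.compl (Q.op τ x) := by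
  unfold op
  induction (Finset.univ : Finset I).toList with
  | nil => rfl
  | cons i L ih => rw [List.foldr_cons, ih, h.word_compl, List.foldr_cons]

lemma Laws.isUltra_op {F : A → Prop} (hF : IsUltra Q F) (τ : I → List Bool) :
    IsUltra Q fun x => F (Q.op τ x) :=
  ⟨fun x y => by rw [h.op_inf, hF.inf], fun x => by rw [h.op_compl, hF.compl]⟩

end Substitutions

section Stages

variable (h : Q.Laws)

/-- A family of elements that behaves like a binary relation between two coordinates. -/
structure IsBinary (Q : DCAOps I A) (B : I → I → A) : Prop where
  word : ∀ {i j k}, i ≠ j → i ≠ k → j ≠ k → ∀ t, Q.word t k (B i j) = B i j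
  left : ∀ {i j k}, i ≠ j → i ≠ k → j ≠ k → Q.Le (Q.inf (Q.d i k) (B i j)) (B k j)
  right : ∀ {i j k}, i ≠ j → i ≠ k → j ≠ k → Q.Le (Q.inf (Q.d j k) (B i j)) (B i k)

include h

lemma Laws.isBinary_d : IsBinary Q Q.d where
  word hij hik hjk t := h.word_d hij hik hjk t
  left _ _ _ := h.d_trans _ _ _
  right {i j _} _ _ _ := by
    rw [h.d_comm i j, h.inf_comm]
    exact h.d_trans _ _ _

/-- The element expressing that the `i`-th coordinate is related to the `j`-th one. -/
def mem (Q : DCAOps I A) (i j : I) : A := Q.cUp j (Q.d i j)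

lemma Laws.isBinary_mem : IsBinary Q Q.mem where
  word hij hik hjk t :=
    (h.word_stp hjk.symm t (.inl true) _).trans (congrArg _ (h.word_d hij hik hjk t))
  left hij hik hjk := h.d_inf_cUp_le_left hij hik hjk
  right hij hik hjk := h.d_inf_cUp_le_right hij hik hjk

omit [Fintype I] [DecidableEq I] h in
lemma IsBinary.swap {B : I → I → A} (hB : IsBinary Q B) : IsBinary Q fun i j => B j i where
  word hij hik hjk t := hB.word hij.symm hjk hik t
  left hij hik hjk := hB.right hij.symm hjk hik
  right hij hik hjk := hB.left hij.symm hjk hik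

lemma Laws.op_binary {B : I → I → A} (hB : IsBinary Q B) {i j : I} (hij : i ≠ j)
    (τ : I → List Bool) : Q.op τ (B i j) = Q.word (τ i) i (Q.word (τ j) j (B i j)) := by
  rw [← op_single (Q := Q) j, ← op_single (Q := Q) i, h.op_op]
  refine h.op_congr fun k => ?_
  rcases eq_or_ne k i with rfl | hki
  · simp [hij]
  rcases eq_or_ne k j with rfl | hkj
  · simp [hij.symm]
  · exact .inr (hB.word hij hki.symm hkj.symm)

variable {F : A → Prop} (hF : IsUltra Q F) (hd : F Q.diagAll)

include hF hd

lemma Laws.diag_mem (i j : I) : F (Q.d i j) := by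
  have key : ∀ L : List I,
      F (L.foldr (fun i y => Q.inf (Q.d (Classical.arbitrary I) i) y) Q.top) →
      ∀ i ∈ L, F (Q.d (Classical.arbitrary I) i) := by
    intro L
    induction L with
    | nil => simp
    | cons i L ih =>
      intro hL
      rw [List.foldr_cons, hF.inf] at hL
      exact List.forall_mem_cons.2 ⟨hL.1, ih hL.2⟩
  have := key _ hd
  exact hF.mono (h.d_trans i j _) ((hF.inf _ _).2 ⟨this i (by simp), this j (by simp)⟩)

lemma Laws.op_d_refl {τ : I → List Bool} {i j : I} (hτ : τ i = τ j) : F (Q.op τ (Q.d i j)) := by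
  rcases eq_or_ne i j with rfl | hij
  · rw [h.d_self]
    exact (h.isUltra_op hF τ).top h
  · rw [h.op_binary h.isBinary_d hij, hτ]
    exact hF.mono (h.d_le_word_word hij _) (h.diag_mem hF hd i j)

omit hF hd in
lemma Laws.op_binary_left {B : I → I → A} (hB : IsBinary Q B) (hF : IsUltra Q F)
    (hd : F Q.diagAll) {i j k : I} (hij : i ≠ j) (hkj : k ≠ j) {τ τ' : I → List Bool}
    (hi : τ i = τ' k) (hj : τ j = τ' j) (hτ : F (Q.op τ (B i j))) : F (Q.op τ' (B k j)) := by
  have hτ' : F (Q.op (update τ k (τ i)) (B k j)) := by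
    rcases eq_or_ne i k with rfl | hik
    · rwa [update_eq_self]
    have e : Q.op τ (B i j) = Q.op (update τ k (τ i)) (B i j) := by
      refine h.op_congr fun l => ?_
      rcases eq_or_ne l k with rfl | hl
      · exact .inr (hB.word hij hik hkj.symm)
      · exact .inl (update_of_ne hl _ _).symm
    rw [e] at hτ
    have hU := h.isUltra_op hF (update τ k (τ i))
    exact hU.mono (hB.left hij hik hkj.symm) ((hU.inf _ _).2
      ⟨h.op_d_refl hF hd (by rw [update_self, update_of_ne hik]), hτ⟩)
  have e : Q.op τ' (B k j) = Q.op (update τ k (τ i)) (B k j) := by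
    refine h.op_congr fun l => ?_
    rcases eq_or_ne l k with rfl | hlk
    · exact .inl (by rw [update_self, hi])
    rcases eq_or_ne l j with rfl | hlj
    · exact .inl (by rw [update_of_ne hlk, hj])
    · exact .inr (hB.word hkj hlk.symm hlj.symm)
  rwa [e]

variable (h3 : ∀ i j : I, ∃ k, i ≠ k ∧ j ≠ k)
include h3

/-- Truth of a binary relation only depends on the terms for the two related coordinates. -/
lemma Laws.op_binary_transfer {B : I → I → A} (hB : IsBinary Q B) {i j k l : I} (hij : i ≠ j)
    (hkl : k ≠ l) {τ τ' : I → List Bool} (hi : τ i = τ' k) (hj : τ j = τ' l)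
    (hτ : F (Q.op τ (B i j))) : F (Q.op τ' (B k l)) := by
  have key : ∀ {j} {τ : I → List Bool}, i ≠ j → k ≠ j → τ i = τ' k → τ j = τ' l →
      F (Q.op τ (B i j)) → F (Q.op τ' (B k l)) := by
    intro j τ hij hkj hi hj hτ
    have h₁ := h.op_binary_left hB hF hd hij hkj (τ := τ) (τ' := update τ k (τ i))
      (by simp) (by simp [hkj.symm]) hτ
    exact h.op_binary_left hB.swap hF hd hkj.symm hkl.symm (by simp [hkj.symm, hj])
      (by simp [hi]) h₁
  rcases eq_or_ne k j with rfl | hkj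
  · obtain ⟨m, him, hkm⟩ := h3 i k
    refine key him hkm (τ := update τ m (τ k)) (by simp [him, hi]) (by simp [hj]) ?_
    exact h.op_binary_left hB.swap hF hd hij.symm him.symm (by simp) (by simp [him]) hτ
  · exact key hij hkj hi hj hτ

omit h3 in
lemma Laws.word_of_d_inf {B Y y : A} {i j : I} (t t' : List Bool)
    (hB : F (Q.word t i (Q.word t' j B))) (hY : F (Q.word t i Y))
    (heq : Q.inf (Q.d i j) (Q.word t' i y) =
      Q.inf (Q.d i j) (Q.cyl i (Q.inf (Q.word t' j B) Y))) : F (Q.word t' i y) := by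
  have h₁ : F (Q.word t i (Q.inf (Q.word t' j B) Y)) := by
    rw [h.word_inf, hF.inf]
    exact ⟨hB, hY⟩
  have h₂ := hF.mono (h.word_mono t i (h.le_cyl i _)) h₁
  rw [h.word_cyl] at h₂
  have h₃ := (hF.inf _ _).2 ⟨h.diag_mem hF hd i j, h₂⟩
  rw [← heq, hF.inf] at h₃
  exact h₃.2

lemma Laws.op_subst {i j : I} (hij : i ≠ j) {τ τ' : I → List Bool}
    (hτ : F (Q.op τ (Q.d i j))) (hi : τ i = τ' i) {x : A} (hx : F (Q.op τ' x)) :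
    F (Q.op (update τ' i (τ j)) x) := by
  rw [h.op_binary h.isBinary_d hij] at hτ
  rw [h.op_eq_word τ' i, ← hi] at hx
  rw [h.op_update]
  exact h.word_of_d_inf hF hd _ _ hτ hx (h.d_inf_word h3 hij _ _)

omit hF hd h3 in
lemma Laws.isBinary_stp (b : Bool) : IsBinary Q fun i j => Q.stp (.inl b) j (Q.d i j) := by
  cases b
  · have e : ∀ {i j}, i ≠ j → Q.stp (.inl false) j (Q.d i j) = Q.mem j i :=
      fun hij => h.cDown_d hij
    have hB := h.isBinary_mem.swap
    refine ⟨fun hij hik hjk t => ?_, fun hij hik hjk => ?_, fun hij hik hjk => ?_⟩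
    · rw [e hij, hB.word hij hik hjk]
    · rw [e hij, e hjk.symm]
      exact hB.left hij hik hjk
    · rw [e hij, e hik]
      exact hB.right hij hik hjk
  · exact h.isBinary_mem

lemma Laws.op_stp_of_rel {i j : I} (hij : i ≠ j) (b : Bool) {τ τ' : I → List Bool}
    (hτ : F (Q.op τ (Q.stp (.inl b) j (Q.d i j)))) (hi : τ i = τ' i) {x : A}
    (hx : F (Q.op τ' x)) : F (Q.op (update τ' i (τ j)) (Q.stp (.inl b) i x)) := by
  rw [h.op_binary (h.isBinary_stp b) hij] at hτ
  rw [h.op_eq_word τ' i, ← hi] at hx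
  rw [h.op_update, h.op_stp (update_self _ _ _)]
  exact h.word_of_d_inf hF hd _ _ hτ hx (h.d_inf_word_stp h3 hij _ _ _)

omit h3 in
lemma Laws.exists_succ {i : I} {z : A} (hz : F (Q.cyl i z)) :
    ∃ F', IsUltra Q F' ∧ F' Q.diagAll ∧ (∀ x, F x → F' (Q.op (fun _ => [false]) x)) ∧
      F' (Q.op (update (fun _ => [false]) i [true]) z) := by
  obtain ⟨S, hS⟩ : ∃ S : Set A, ∀ s, s ∈ S ↔ ∃ x, F x ∧ s = Q.inf Q.diagAll
      (Q.inf (Q.op (fun _ => [false]) x) (Q.op (update (fun _ => [false]) i [true]) z)) :=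
    ⟨{s | _}, fun _ => .rfl⟩
  have hinf : ∀ s ∈ S, ∀ t ∈ S, Q.inf s t ∈ S := by
    simp only [hS]
    rintro _ ⟨x, hx, rfl⟩ _ ⟨y, hy, rfl⟩
    refine ⟨_, (hF.inf x y).2 ⟨hx, hy⟩, ?_⟩
    rw [h.op_inf]
    let _ := h.booleanAlgebra
    exact (inf_inf_distrib_left _ _ _).symm.trans
      (congrArg _ (inf_inf_distrib_right _ _ _).symm)
  obtain ⟨F', hF', hSF⟩ := h.exists_isUltra S ⟨_, (hS _).2 ⟨_, hF.top h, rfl⟩⟩ hinf (by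
    rw [hS]
    rintro ⟨x, hx, e⟩
    have h₁ := hF.mono (h.inf_diagAll_inf_cyl_le i x z)
      ((hF.inf _ _).2 ⟨(hF.inf _ _).2 ⟨hx, hd⟩, hz⟩)
    rw [← e, h.cylAll_compl_top, hF.compl] at h₁
    exact h₁ (hF.top h))
  have key : ∀ x, F x → _ := fun x hx => (hF'.inf _ _).1 (hSF _ ((hS _).2 ⟨x, hx, rfl⟩))
  exact ⟨F', hF', (key _ (hF.top h)).1, fun x hx => ((hF'.inf _ _).1 (key x hx).2).1,
    ((hF'.inf _ _).1 (key _ (hF.top h)).2).2⟩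

lemma Laws.exists_stage (b : Bool) (i : I) (ρ : I → List Bool) (x : A) :
    ∃ F', IsUltra Q F' ∧ F' Q.diagAll ∧ (∀ x, F x → F' (Q.op (fun _ => [false]) x)) ∧
      (F (Q.op ρ (Q.stp (.inl b) i x)) → F' (Q.op (update (fun k => false :: ρ k) i [true]) x) ∧
        ∃ j τ, i ≠ j ∧ τ i = [true] ∧ τ j = false :: ρ i ∧
          F' (Q.op τ (Q.stp (.inl b) j (Q.d i j)))) := by
  by_cases hx : F (Q.op ρ (Q.stp (.inl b) i x))
  · obtain ⟨j, hij, -⟩ := h3 i i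
    have hL := h.d_inf_word_stp h3 hij (ρ i) (.inl b) (Q.op (update ρ i []) x)
    rw [h.op_eq_word ρ i, h.op_stp (update_self _ _ _)] at hx
    have h₁ := (hF.inf _ _).2 ⟨h.diag_mem hF hd i j, hx⟩
    rw [hL, hF.inf] at h₁
    obtain ⟨F', hF', hd', hs, hz⟩ := h.exists_succ hF hd h₁.2
    rw [h.op_inf, hF'.inf, h.op_op, ← op_single, h.op_op] at hz
    refine ⟨F', hF', hd', hs, fun _ => ⟨?_, j, _, hij, ?_, ?_, hz.1⟩⟩
    · convert hz.2 using 2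
      funext k
      rcases eq_or_ne k i with rfl | hk
      · simp
      · simp [hk]
    · simp [hij]
    · simp [hij.symm]
  · obtain ⟨F', hF', hd', hs, -⟩ :=
      h.exists_succ hF hd (hF.mono (h.le_cyl i Q.top) (hF.top h))
    exact ⟨F', hF', hd', hs, fun hx' => absurd hx' hx⟩

end Stages

section Chains

/-- Truth of the elements of `Q` at tuples of points, which respects all operations, except that
the directed cylindrifications of an element only need to have witnesses if it is in `S`. -/
structure PreRep (Q : DCAOps I A) (S : Set A) {U : Type} (T : A → (I → U) → Prop)
    (e : U → U → Prop) (r : Bool → U → U → Prop) : Prop where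
  inf : ∀ x y n, T (Q.inf x y) n ↔ T x n ∧ T y n
  compl : ∀ x n, T (Q.compl x) n ↔ ¬ T x n
  diag : ∀ i j n, T (Q.d i j) n ↔ e (n i) (n j)
  subst : ∀ x n i u, e (n i) u → T x n → T x (update n i u)
  rel : ∀ b i j n, i ≠ j → (T (Q.stp (.inl b) j (Q.d i j)) n ↔ r b (n i) (n j))
  stp : ∀ b x n i u, r b (n i) u → T x n → T (Q.stp (.inl b) i x) (update n i u)
  exists_of_stp : ∀ b, ∀ x ∈ S, ∀ n i, T (Q.stp (.inl b) i x) n →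
    ∃ u, r b u (n i) ∧ T x (update n i u)

/-- The term at stage `K` of the point that was introduced at stage `u.1` by the term `u.2`. -/
def pad (K : ℕ) (u : ℕ × List Bool) : List Bool := List.replicate (K - u.1) false ++ u.2

lemma pad_succ {K : ℕ} {u : ℕ × List Bool} (hu : u.1 ≤ K) : pad (K + 1) u = false :: pad K u := by
  rw [pad, Nat.succ_sub hu, List.replicate_succ]
  rfl

lemma pad_self (K : ℕ) (t : List Bool) : pad K (K, t) = t := by
  simp [pad]

/-- `F` is a chain of ultrafilters, each of which describes a point coding the points described
by the previous one together with a witness for the demand `D`. -/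
structure IsChain (Q : DCAOps I A) (F : ℕ → A → Prop)
    (D : ℕ → Bool × I × (I → ℕ × List Bool) × A) : Prop where
  isUltra : ∀ K, IsUltra Q (F K)
  diagAll : ∀ K, F K Q.diagAll
  succ : ∀ K x, F K x → F (K + 1) (Q.op (fun _ => [false]) x)
  witness : ∀ K b i n x, D K = (b, i, n, x) → F K (Q.op (pad K ∘ n) (Q.stp (.inl b) i x)) →
    F (K + 1) (Q.op (update (fun k => false :: pad K (n k)) i [true]) x) ∧
      ∃ j τ, i ≠ j ∧ τ i = [true] ∧ τ j = false :: pad K (n i) ∧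
        F (K + 1) (Q.op τ (Q.stp (.inl b) j (Q.d i j)))

variable (h : Q.Laws) (h3 : ∀ i j : I, ∃ k, i ≠ k ∧ j ≠ k)

include h h3 in
lemma Laws.exists_isChain {F₀ : A → Prop} (hF : IsUltra Q F₀) (hd : F₀ Q.diagAll)
    (D : ℕ → Bool × I × (I → ℕ × List Bool) × A) : ∃ F, IsChain Q F D ∧ F 0 = F₀ := by
  have key : ∀ (F : {F : A → Prop // IsUltra Q F ∧ F Q.diagAll}) (K : ℕ),
      ∃ F' : {F : A → Prop // IsUltra Q F ∧ F Q.diagAll},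
        (∀ x, F.1 x → F'.1 (Q.op (fun _ => [false]) x)) ∧
        ∀ b i n x, D K = (b, i, n, x) → F.1 (Q.op (pad K ∘ n) (Q.stp (.inl b) i x)) →
          F'.1 (Q.op (update (fun k => false :: pad K (n k)) i [true]) x) ∧
            ∃ j τ, i ≠ j ∧ τ i = [true] ∧ τ j = false :: pad K (n i) ∧
              F'.1 (Q.op τ (Q.stp (.inl b) j (Q.d i j))) := by
    rintro ⟨F, hF, hd⟩ K
    obtain ⟨F', hF', hd', hs, hw⟩ :=
      h.exists_stage hF hd h3 (D K).1 (D K).2.1 (pad K ∘ (D K).2.2.1) (D K).2.2.2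
    refine ⟨⟨F', hF', hd'⟩, hs, fun b i n x e => ?_⟩
    rw [e] at hw
    exact hw
  choose next hs hw using key
  let G : ℕ → {F : A → Prop // IsUltra Q F ∧ F Q.diagAll} :=
    fun K => Nat.rec ⟨F₀, hF, hd⟩ (fun K F => next F K) K
  exact ⟨fun K => (G K).1, ⟨fun K => (G K).2.1, fun K => (G K).2.2, fun K => hs (G K) K,
    fun K => hw (G K) K⟩, rfl⟩

/-- Truth along a chain. -/
def truth (Q : DCAOps I A) (F : ℕ → A → Prop) (x : A) (n : I → ℕ × List Bool) : Prop :=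
  ∀ K, (∀ i, (n i).1 ≤ K) → F K (Q.op (pad K ∘ n) x)

/-- The relation between points that is described by a binary family of elements. -/
def relOf (T : A → (I → ℕ × List Bool) → Prop) (B : I → I → A) (u u' : ℕ × List Bool) : Prop :=
  ∃ i j n, i ≠ j ∧ n i = u ∧ n j = u' ∧ T (B i j) n

variable {F : ℕ → A → Prop} {D : ℕ → Bool × I × (I → ℕ × List Bool) × A} (hF : IsChain Q F D)

include h hF

lemma IsChain.op_succ_iff {K : ℕ} {n : I → ℕ × List Bool} (hn : ∀ i, (n i).1 ≤ K) (x : A) :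
    F (K + 1) (Q.op (pad (K + 1) ∘ n) x) ↔ F K (Q.op (pad K ∘ n) x) := by
  have e : ∀ x, Q.op (pad (K + 1) ∘ n) x = Q.op (fun _ => [false]) (Q.op (pad K ∘ n) x) := by
    intro x
    rw [h.op_op]
    congr 1
    funext i
    exact pad_succ (hn i)
  rw [e]
  refine ⟨fun hx => ?_, hF.succ K _⟩
  by_contra hx'
  have := hF.succ K _ (((hF.isUltra K).compl _).2 hx')
  rw [h.op_compl, (hF.isUltra _).compl] at this
  exact this hx

lemma IsChain.truth_iff {K : ℕ} {n : I → ℕ × List Bool} (hn : ∀ i, (n i).1 ≤ K) (x : A) :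
    truth Q F x n ↔ F K (Q.op (pad K ∘ n) x) := by
  have key : ∀ K K', K ≤ K' → (∀ i, (n i).1 ≤ K) →
      (F K' (Q.op (pad K' ∘ n) x) ↔ F K (Q.op (pad K ∘ n) x)) := by
    intro K K' hK hn
    induction K', hK using Nat.le_induction with
    | base => rfl
    | succ K' hK ih => exact (hF.op_succ_iff h (fun i => (hn i).trans hK) x).trans ih
  refine ⟨fun hx => hx K hn, fun hx K' hn' => ?_⟩
  rcases le_total K K' with hK | hK
  · exact (key _ _ hK hn).2 hx
  · exact (key _ _ hK hn').1 hx

omit h hF [Nontrivial I] [DecidableEq I] in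
lemma exists_stage_bound (n : I → ℕ × List Bool) : ∃ K, ∀ i, (n i).1 ≤ K :=
  Finite.exists_le fun i => (n i).1

include h3

lemma IsChain.truth_iff_relOf {B : I → I → A} (hB : IsBinary Q B) {i j : I} (hij : i ≠ j)
    (n : I → ℕ × List Bool) : truth Q F (B i j) n ↔ relOf (truth Q F) B (n i) (n j) := by
  refine ⟨fun hn => ⟨i, j, n, hij, rfl, rfl, hn⟩, ?_⟩
  rintro ⟨k, l, n', hkl, hk, hl, hn'⟩
  obtain ⟨K₁, hK₁⟩ := exists_stage_bound n
  obtain ⟨K₂, hK₂⟩ := exists_stage_bound n'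
  rw [hF.truth_iff h fun i => (hK₁ i).trans (le_max_left K₁ K₂)]
  rw [hF.truth_iff h fun i => (hK₂ i).trans (le_max_right K₁ K₂)] at hn'
  exact h.op_binary_transfer (hF.isUltra _) (hF.diagAll _) h3 hB hkl hij
    (congrArg (pad _) hk) (congrArg (pad _) hl) hn'

lemma IsChain.preRep {S : Set A}
    (hD : ∀ b i n, ∀ x ∈ S, ∀ N, ∃ K ≥ N, D K = (b, i, n, x)) :
    PreRep Q S (truth Q F) (relOf (truth Q F) Q.d)
      fun b => relOf (truth Q F) fun i j => Q.stp (.inl b) j (Q.d i j) where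
  inf x y n := by
    obtain ⟨K, hK⟩ := exists_stage_bound n
    rw [hF.truth_iff h hK, hF.truth_iff h hK, hF.truth_iff h hK, h.op_inf, (hF.isUltra K).inf]
  compl x n := by
    obtain ⟨K, hK⟩ := exists_stage_bound n
    rw [hF.truth_iff h hK, hF.truth_iff h hK, h.op_compl, (hF.isUltra K).compl]
  diag i j n := by
    rcases eq_or_ne i j with rfl | hij
    · obtain ⟨j, hij⟩ := exists_ne i
      have hrefl : ∀ i j (m : I → ℕ × List Bool), m i = m j → truth Q F (Q.d i j) m :=
        fun i j m hm K _ => h.op_d_refl (hF.isUltra K) (hF.diagAll K) (congrArg (pad K) hm)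
      exact iff_of_true (hrefl _ _ _ rfl)
        ⟨i, j, fun _ => n i, hij.symm, rfl, rfl, hrefl _ _ _ rfl⟩
    · exact hF.truth_iff_relOf h h3 h.isBinary_d hij n
  subst x n i u hu hx := by
    obtain ⟨j, hij, -⟩ := h3 i i
    obtain ⟨N, hN⟩ := exists_stage_bound n
    have hn : ∀ k, (n k).1 ≤ max N u.1 := fun k => (hN k).trans (le_max_left _ _)
    have hn' : ∀ j k, (update n j u k).1 ≤ max N u.1 := by
      intro j k
      rw [update_apply]
      split_ifs
      exacts [le_max_right _ _, hn k]
    have hd := (hF.truth_iff_relOf h h3 h.isBinary_d hij (update n j u)).2 (by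
      rwa [update_self, update_of_ne hij])
    rw [hF.truth_iff h (hn' j)] at hd
    rw [hF.truth_iff h hn] at hx
    rw [hF.truth_iff h (hn' i), comp_update]
    have := h.op_subst (hF.isUltra _) (hF.diagAll _) h3 hij hd
      (τ' := pad _ ∘ n) (congrArg (pad _) (update_of_ne hij u n)) hx
    rwa [comp_apply, update_self] at this
  rel b i j n hij := hF.truth_iff_relOf h h3 (h.isBinary_stp b) hij n
  stp b x n i u hu hx := by
    obtain ⟨j, hij, -⟩ := h3 i i
    obtain ⟨N, hN⟩ := exists_stage_bound n
    have hn : ∀ k, (n k).1 ≤ max N u.1 := fun k => (hN k).trans (le_max_left _ _)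
    have hn' : ∀ j k, (update n j u k).1 ≤ max N u.1 := by
      intro j k
      rw [update_apply]
      split_ifs
      exacts [le_max_right _ _, hn k]
    have hd := (hF.truth_iff_relOf h h3 (h.isBinary_stp b) hij (update n j u)).2 (by
      rwa [update_self, update_of_ne hij])
    rw [hF.truth_iff h (hn' j)] at hd
    rw [hF.truth_iff h hn] at hx
    rw [hF.truth_iff h (hn' i), comp_update]
    have := h.op_stp_of_rel (hF.isUltra _) (hF.diagAll _) h3 hij b hd
      (τ' := pad _ ∘ n) (congrArg (pad _) (update_of_ne hij u n)) hx
    rwa [comp_apply, update_self] at this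
  exists_of_stp b x hx n i hn := by
    obtain ⟨N, hN⟩ := exists_stage_bound n
    obtain ⟨K, hK, hDK⟩ := hD b i n x hx N
    have hnK : ∀ i, (n i).1 ≤ K := fun i => (hN i).trans hK
    rw [hF.truth_iff h hnK] at hn
    obtain ⟨hx', j, τ, hij, hi, hj, hτ⟩ := hF.witness K b i n x hDK hn
    refine ⟨(K + 1, [true]), ⟨i, j, update (fun _ => n i) i (K + 1, [true]), hij, ?_, ?_, ?_⟩, ?_⟩
    · rw [update_self]
    · rw [update_of_ne hij.symm]
    · rw [hF.truth_iff h (K := K + 1)]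
      · refine h.op_binary_transfer (hF.isUltra _) (hF.diagAll _) h3 (h.isBinary_stp b) hij hij
          ?_ ?_ hτ
        · simp [hi, pad_self]
        · simp [hj, hij.symm, pad_succ (hnK i)]
      · intro k
        rcases eq_or_ne k i with rfl | hk
        · simp
        · simpa [hk] using (hnK i).trans K.le_succ
    · rw [hF.truth_iff h (K := K + 1)]
      · convert hx' using 2
        rw [comp_update, pad_self]
        congr 1
        funext k
        exact pad_succ (hnK k)
      · intro k
        rcases eq_or_ne k i with rfl | hk
        · simp
        · simpa [hk] using (hnK k).trans K.le_succ

end Chains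

section Representation

lemma Laws.exists_preRep (h : Q.Laws) (h3 : ∀ i j : I, ∃ k, i ≠ k ∧ j ≠ k) {S : Set A}
    (hS : S.Countable) {a : A} (ha : a ≠ Q.compl Q.top) :
    ∃ (T : A → (I → ℕ × List Bool) → Prop) (e : ℕ × List Bool → ℕ × List Bool → Prop)
      (r : Bool → ℕ × List Bool → ℕ × List Bool → Prop), PreRep Q S T e r ∧ ∃ n, T a n := by
  have hE : ((Set.univ : Set Bool) ×ˢ (Set.univ : Set I) ×ˢ
      (Set.univ : Set (I → ℕ × List Bool)) ×ˢ insert a S).Countable :=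
    Set.countable_univ.prod (Set.countable_univ.prod (Set.countable_univ.prod (hS.insert a)))
  obtain ⟨E, hE⟩ := hE.exists_eq_range
    ⟨(true, Classical.arbitrary I, fun _ => (0, []), a), by simp⟩
  have hne : Q.inf Q.diagAll (Q.op entries a) ≠ Q.compl Q.top := by
    intro e
    obtain ⟨F, hF, hFa⟩ := h.exists_isUltra_of_ne ha
    have := hF.mono (h.le_cylAll_entries a) hFa
    rw [e, h.cylAll_compl_top, hF.compl] at this
    exact this (hF.top h)
  obtain ⟨F₀, hF₀, hF₀a⟩ := h.exists_isUltra_of_ne hne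
  rw [hF₀.inf] at hF₀a
  obtain ⟨F, hF, rfl⟩ := h.exists_isChain h3 hF₀ hF₀a.1 fun K => E K.unpair.1
  refine ⟨_, _, _, hF.preRep h h3 fun b i n x hx N => ?_, fun i => (0, entries i), ?_⟩
  · have : (b, i, n, x) ∈ Set.range E := by
      rw [← hE]
      simp [hx]
    obtain ⟨m, hm⟩ := this
    exact ⟨Nat.pair m N, Nat.right_le_pair m N, by simpa using hm⟩
  · rw [hF.truth_iff h (K := 0) fun _ => le_rfl]
    convert hF₀a.2
    funext i
    exact pad_self 0 _

omit [Nontrivial I] [Fintype I] in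
lemma update_eval {J U : Type} (n : I → J → U) (i : I) (u : J → U) (j : J) :
    (fun k => update n i u k j) = update (fun k => n k j) i (u j) :=
  comp_update (fun f : J → U => f j) n i u

omit [Fintype I] in
lemma PreRep.ultraproduct {J U : Type} {S : J → Set A} {T : J → A → (I → U) → Prop}
    {e : J → U → U → Prop} {r : J → Bool → U → U → Prop}
    (H : ∀ j, PreRep Q (S j) (T j) (e j) (r j)) (𝒰 : Ultrafilter J)
    (hS : ∀ x, ∀ᶠ j in 𝒰, x ∈ S j) :
    PreRep (U := J → U) Q Set.univ (fun x n => ∀ᶠ j in 𝒰, T j x fun i => n i j)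
      (fun u v => ∀ᶠ j in 𝒰, e j (u j) (v j)) fun b u v => ∀ᶠ j in 𝒰, r j b (u j) (v j) where
  inf x y n := by simp only [(H _).inf, Filter.eventually_and]
  compl x n := by simp only [(H _).compl, Ultrafilter.eventually_not]
  diag i j n := by simp only [(H _).diag]
  subst x n i u hu hx := by
    filter_upwards [hu, hx] with j hu hx
    rw [update_eval]
    exact (H j).subst _ _ _ _ hu hx
  rel b i j n hij := by simp only [(H _).rel _ _ _ _ hij]
  stp b x n i u hu hx := by
    filter_upwards [hu, hx] with j hu hx
    rw [update_eval]
    exact (H j).stp _ _ _ _ _ hu hx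
  exists_of_stp b x _ n i hn := by
    have : ∀ j, ∃ u, x ∈ S j → (T j (Q.stp (.inl b) i x) fun k => n k j) →
        r j b u (n i j) ∧ T j x (update (fun k => n k j) i u) := by
      intro j
      by_cases hj : x ∈ S j ∧ T j (Q.stp (.inl b) i x) fun k => n k j
      · exact ((H j).exists_of_stp b x hj.1 _ i hj.2).imp fun u hu _ _ => hu
      · exact ⟨n i j, fun h₁ h₂ => (hj ⟨h₁, h₂⟩).elim⟩
    choose u hu using this
    refine ⟨u, ?_, ?_⟩
    · filter_upwards [hS x, hn] with j h₁ h₂ using (hu j h₁ h₂).1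
    · filter_upwards [hS x, hn] with j h₁ h₂
      rw [update_eval]
      exact (hu j h₁ h₂).2

lemma Laws.exists_preRep_univ (h : Q.Laws) (h3 : ∀ i j : I, ∃ k, i ≠ k ∧ j ≠ k) {a : A}
    (ha : a ≠ Q.compl Q.top) : ∃ (U : Type) (T : A → (I → U) → Prop) (e : U → U → Prop)
      (r : Bool → U → U → Prop), PreRep Q Set.univ T e r ∧ ∃ n, T a n := by
  classical
  choose T e r H n hn using fun S : Finset A => h.exists_preRep h3 S.countable_toSet ha
  refine ⟨_, _, _, _, PreRep.ultraproduct H (Ultrafilter.of Filter.atTop) fun x => ?_,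
    fun i S => n S i, .of_forall hn⟩
  refine (Filter.eventually_ge_atTop ({x} : Finset A)).filter_mono (Ultrafilter.of_le _) |>.mono
    fun S hS => ?_
  simpa using hS

section Quotient

variable {U : Type} {T : A → (I → U) → Prop} {e : U → U → Prop} {r : Bool → U → U → Prop}
  (h : Q.Laws) (H : PreRep Q Set.univ T e r)

include H

lemma PreRep.of_forall {x : A} {n n' : I → U} (hn : ∀ i, e (n i) (n' i)) (hx : T x n) :
    T x n' := by
  have key : ∀ s : Finset I, T x (s.piecewise n' n) := by
    intro s
    induction s using Finset.induction_on with
    | empty => simpa using hx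
    | insert i s hi ih =>
      rw [Finset.piecewise_insert]
      exact H.subst _ _ _ _ (by simpa [hi] using hn i) ih
  simpa using key Finset.univ

include h

lemma PreRep.equivalence : Equivalence e := by
  obtain ⟨i, j, hij⟩ := exists_pair_ne I
  have refl : ∀ u, e u u := by
    intro u
    have htop : T Q.top fun _ : I => u := by
      by_contra hn
      rw [← H.compl, ← h.inf_compl Q.top, H.inf] at hn
      exact (H.compl _ _).1 hn.2 hn.1
    rw [← h.d_self i] at htop
    exact (H.diag i i _).1 htop
  have symm : ∀ {u v}, e u v → e v u := by
    intro u v huv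
    have := (H.diag i j (update (fun _ => u) j v)).2 (by simpa [hij] using huv)
    rw [h.d_comm, H.diag] at this
    simpa [hij] using this
  refine ⟨refl, symm, fun {u v w} huv hvw => ?_⟩
  have := H.subst (Q.d i j) (update (fun _ => u) j v) j w (by simpa using hvw)
    ((H.diag _ _ _).2 (by simpa [hij] using huv))
  rw [H.diag] at this
  simpa [hij] using this

omit h in
lemma PreRep.rel_congr {b : Bool} {u v u' v' : U} (hu : e u u') (hv : e v v') (hr : r b u v) :
    r b u' v' := by
  obtain ⟨i, j, hij⟩ := exists_pair_ne I
  have := H.of_forall (n := update (fun _ => u) j v) (n' := update (fun _ => u') j v')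
    (fun k => by
      rcases eq_or_ne k j with rfl | hk
      · simpa using hv
      · simpa [hk] using hu)
    ((H.rel b i j _ hij).2 (by simpa [hij] using hr))
  rw [H.rel b i j _ hij] at this
  simpa [hij] using this

lemma PreRep.rel_comm {u v : U} : r false u v ↔ r true v u := by
  obtain ⟨i, j, hij⟩ := exists_pair_ne I
  have h₁ := H.rel false i j (update (fun _ => u) j v) hij
  have h₂ := H.rel true j i (update (fun _ => u) j v) hij.symm
  have : Q.stp (.inl false) j (Q.d i j) = Q.stp (.inl true) i (Q.d j i) := h.cDown_d hij
  rw [this] at h₁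
  simpa [hij] using h₁.symm.trans h₂

omit [Fintype I] h in
lemma PreRep.stp_iff {b : Bool} {i : I} {x : A} {n : I → U} :
    T (Q.stp (.inl b) i x) n ↔ ∃ u, r b u (n i) ∧ T x (update n i u) := by
  refine ⟨H.exists_of_stp b x trivial n i, ?_⟩
  rintro ⟨u, hu, hx⟩
  simpa using H.stp b x _ i (n i) (by simpa using hu) hx

lemma PreRep.exists_isHom {a : A} {n : I → U} (hn : T a n) :
    ∃ (V : Type) (R : V → V → Prop) (φ : A → Set (I → V)),
      IsHom φ Q (full I R) ∧ (φ a).Nonempty := by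
  have he := H.equivalence h
  let S : Setoid U := ⟨e, he⟩
  have hout : ∀ u : U, e u (⟦u⟧ : Quotient S).out := fun u => he.symm (Quotient.mk_out (s := S) u)
  have key : ∀ b i x (s : I → Quotient S), T (Q.stp (.inl b) i x) (Quotient.out ∘ s) ↔
      ∃ v : Quotient S, r b v.out (s i).out ∧ T x (Quotient.out ∘ update s i v) := by
    intro b i x s
    rw [H.stp_iff]
    simp only [comp_update]
    refine ⟨?_, fun ⟨v, hv⟩ => ⟨_, hv⟩⟩
    rintro ⟨u, hu, hx⟩
    refine ⟨⟦u⟧, H.rel_congr (hout u) (he.refl _) hu, ?_⟩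
    simpa using H.subst x _ i (⟦u⟧ : Quotient S).out (by simpa using hout u) hx
  refine ⟨Quotient S, fun u v => r true u.out v.out, fun x => {s | T x (Quotient.out ∘ s)},
    ⟨fun x y => ?_, fun x => ?_, fun i x => ?_, fun i x => ?_, fun i j => ?_⟩,
    fun i => ⟦n i⟧, H.of_forall (fun i => hout (n i)) hn⟩ <;> ext s
  · exact H.inf x y _
  · exact H.compl x _
  · rw [mem_cUp]
    exact key true i x s
  · rw [mem_cDown]
    simp only [← H.rel_comm h]
    exact key false i x s
  · rw [mem_d]
    exact (H.diag i j _).trans (Quotient.out_equiv_out (s := S))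

end Quotient

section Base

variable {V : Type} {R : V → V → Prop} {φ : A → Set (I → V)} (h : Q.Laws)
  (hφ : IsHom φ Q (full I R)) {i j k : I} (hij : i ≠ j) (hik : i ≠ k) (hjk : j ≠ k)

include h hφ hij hik hjk

lemma IsHom.isPStructure : IsPStructure R := by
  intro a b
  have := congrArg φ (h.pairing hij hik hjk)
  simp only [hφ.cyl, hφ.inf, hφ.cUp, hφ.compl, hφ.d, hφ.top] at this
  have hs := (Set.ext_iff.1 this (update (fun _ => a) j b)).2 mem_top
  simp only [DCAOps.cyl, mem_cUp, mem_cDown, mem_inf, mem_compl, mem_d] at hs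
  obtain ⟨_, -, c, -, ⟨⟨u, hu, hua⟩, v, hv, hvb⟩, hc⟩ := hs
  simp [hij, hik, hjk] at hu hua hv hvb hc
  subst hua hvb
  exact ⟨c, fun d => ⟨fun hd => by_contra fun hd' => by grind,
    by rintro (rfl | rfl) <;> assumption⟩⟩

lemma IsHom.isExtensional : IsExtensional R := by
  intro a b hab
  have := congrArg φ (h.extensionality hij hik hjk)
  simp only [hφ.cyl, hφ.inf, hφ.cUp, hφ.compl, hφ.d] at this
  have hs : update (fun _ => a) j b ∈ _ → update (fun _ => a) j b ∈ _ :=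
    fun hs => Set.inter_eq_left.1 this hs
  simp only [DCAOps.cyl, mem_cUp, mem_cDown, mem_inf, mem_compl, mem_d] at hs
  simp [hij, hik, hjk, hik.symm, hjk.symm] at hs
  grind

end Base

lemma Laws.isRepresentableDCA (h : Q.Laws) {i j k : I} (hij : i ≠ j) (hik : i ≠ k) (hjk : j ≠ k) :
    IsRepresentableDCA Q := by
  have h3 : ∀ i' j' : I, ∃ k', i' ≠ k' ∧ j' ≠ k' := by
    intro i' j'
    by_contra! hk
    have h₁ := hk i
    have h₂ := hk j
    have h₃ := hk k
    by_cases hi : i' = i <;> by_cases hj : i' = j <;> grind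
  have key : ∀ a : {a // a ≠ Q.compl Q.top}, ∃ (V : Type) (R : V → V → Prop) (φ : A → Set (I → V)),
      IsHom φ Q (full I R) ∧ (φ a).Nonempty := by
    rintro ⟨a, ha⟩
    obtain ⟨U, T, e, r, H, n, hn⟩ := h.exists_preRep_univ h3 ha
    exact H.exists_isHom h hn
  choose V R φ hφ hne using key
  have hP : ∀ a, IsPStructure (R a) := fun a => (hφ a).isPStructure h hij hik hjk
  refine ⟨_, V, R, fun a => ⟨(hP a).isWeakPStructure, hP a,
    (hφ a).isExtensional h hij hik hjk⟩, fun x a => φ a x, ?_, fun x y a => (hφ a).inf x y,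
    fun x a => (hφ a).compl x, fun i x a => (hφ a).cUp i x, fun i x a => (hφ a).cDown i x,
    fun i j a => (hφ a).d i j⟩
  have hle : ∀ x y, (∀ a, φ a x = φ a y) → Q.Le x y := by
    intro x y hxy
    by_contra hle
    have ha : Q.inf x (Q.compl y) ≠ Q.compl Q.top := by
      let _ := h.booleanAlgebra
      intro e
      exact hle (inf_eq_left.2 (disjoint_compl_right_iff.1 (disjoint_iff.2 e)))
    obtain ⟨s, hs⟩ := hne ⟨_, ha⟩
    rw [(hφ _).inf, (hφ _).compl, mem_inf, mem_compl, hxy] at hs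
    exact hs.2 hs.1
  intro x y hxy
  have hxy := congrFun hxy
  rw [← hle x y hxy, h.inf_comm, hle y x fun a => (hxy a).symm]

lemma _root_.IsRepresentableDCA.laws (h : IsRepresentableDCA Q) : Q.Laws := by
  obtain ⟨K, U, R, hR, φ, hinj, hinf, hcompl, hUp, hDown, hd⟩ := h
  intro x y z p hp
  refine hinj (funext fun k => ?_)
  have hφ : IsHom (fun x => φ x k) Q (full I (R k)) :=
    ⟨fun x y => hinf x y k, fun x => hcompl x k, fun i x => hUp i x k, fun i x => hDown i x k,
      fun i j => hd i j k⟩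
  refine full_laws (hR k).2.1 (hR k).2.2 (φ x k) (φ y k) (φ z k) (φ p.1 k, φ p.2 k) ?_
  rw [hφ.lawSet]
  exact ⟨p, hp, rfl⟩

end Representation

end Completeness

end DCAOps

/-- For every finite `α ≥ 3`, the class `RCA↑_α` of
representable directed cylindric algebras of dimension `α` is a finitely
axiomatizable variety: there is a finite set `E` of equations of the signature
such that an algebra of the signature is in `RCA↑_α` iff it satisfies every
equation of `E`. -/
theorem statement18 (α : ℕ) (hα : 3 ≤ α) :
    ∃ E : Set (DTerm (Fin α) × DTerm (Fin α)), E.Finite ∧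
      ∀ (A : Type) (Q : DCAOps (Fin α) A),
        IsRepresentableDCA Q ↔
          ∀ p ∈ E, ∀ v : ℕ → A, DTerm.realize Q v p.1 = DTerm.realize Q v p.2 := by
  have : Nontrivial (Fin α) := Fin.nontrivial_iff_two_le.2 (by omega)
  refine ⟨DCAOps.equations (Fin α), DCAOps.finite_equations, fun A Q => ?_⟩
  rw [Q.forall_equations_iff]
  refine ⟨IsRepresentableDCA.laws, fun h => h.isRepresentableDCA (i := ⟨0, by omega⟩)
    (j := ⟨1, by omega⟩) (k := ⟨2, by omega⟩) ?_ ?_ ?_⟩ <;> simp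
end
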